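/- With P = k[x,y,z,w], Φ a degree-3 Macaulay inverse system, ann Φ containing no nonzero linear form, and the map p : P_1 → Hom_k(P_1,k), p(u)(v) = Φ(x·u·v), bijective, the quotient P/ann Φ admits a free resolution of length four with total Betti numbers (1,9,16,9,1): there exist P-linear maps f₄ : P → P⁹, f₃ : P⁹ → P¹⁶, f₂ : P¹⁶ → P⁹, f₁ : P⁹ → P such that f₄ is injective, the pairs (f₄,f₃), (f₃,f₂), (f₂,f₁) are exact (kernel of each map equals the image of the previous one), and the image of f₁ is exactly the ideal ann Φ. -/

import Mathlib

open MvPolynomial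

noncomputable section

variable (k : Type*) [Field k]

/-- The annihilator ideal `ann Φ = {f : Φ(f·g) = 0 for all g}` of the
linear functional `Φ`. -/
def annIdeal (Φ : MvPolynomial (Fin 4) k →ₗ[k] k) : Ideal (MvPolynomial (Fin 4) k) where
  carrier := {f | ∀ g, Φ (f * g) = 0}
  add_mem' := by
    intro a b ha hb g
    rw [add_mul, map_add, ha g, hb g, add_zero]
  zero_mem' := by intro g; simp
  smul_mem' := by
    intro c a ha g
    have h : c • a * g = a * (c * g) := by rw [smul_eq_mul]; ring
    rw [h]; exact ha (c * g)

/-- The Macaulay map `p : P₁ → Hom(P₁, k)`, `p(u)(v) = Φ(x·u·v)`. -/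
def pMap (Φ : MvPolynomial (Fin 4) k →ₗ[k] k) :
    homogeneousSubmodule (Fin 4) k 1 →ₗ[k]
      (homogeneousSubmodule (Fin 4) k 1 →ₗ[k] k) where
  toFun u :=
    { toFun := fun v => Φ (X 0 * u.1 * v.1)
      map_add' := fun v w => by simp [mul_add]
      map_smul' := fun c v => by simp [mul_smul_comm] }
  map_add' u u' := by
    ext v
    simp [add_mul, mul_add]
  map_smul' c u := by
    ext v
    simp [mul_smul_comm, smul_mul_assoc]

section AbstractChase
set_option linter.unusedSimpArgs false
variable {R : Type*} [CommRing R] {M : Type*} [AddCommGroup M] [Module R M]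

def dd1 (G e1 e2 e3 : M →ₗ[R] M) : (M × M × M × M) →ₗ[R] M where
  toFun c := e1 c.1 + e2 c.2.1 + e3 c.2.2.1 + G c.2.2.2
  map_add' a b := by simp; abel
  map_smul' r a := by simp

def dd2 (G e1 e2 e3 z1 z2 z3 h12 h13 h23 : M →ₗ[R] M) :
    (M × M × M × M × M × M) →ₗ[R] (M × M × M × M) where
  toFun c := (- e2 c.1 - e3 c.2.1 + G c.2.2.2.1,
    e1 c.1 - e3 c.2.2.1 + G c.2.2.2.2.1,
    e1 c.2.1 + e2 c.2.2.1 + G c.2.2.2.2.2,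
    - z1 c.2.2.2.1 - z2 c.2.2.2.2.1 - z3 c.2.2.2.2.2 + h12 c.1 + h13 c.2.1 + h23 c.2.2.1)
  map_add' a b := by
    simp only [Prod.fst_add, Prod.snd_add, map_add, Prod.mk_add_mk, Prod.mk.injEq]
    refine ⟨?_, ?_, ?_, ?_⟩ <;> abel
  map_smul' r a := by
    simp [smul_sub, smul_add]

def dd3 (G e1 e2 e3 z1 z2 z3 h12 h13 h23 : M →ₗ[R] M) :
    (M × M × M × M) →ₗ[R] (M × M × M × M × M × M) where
  toFun c := (e3 c.1 + G c.2.1, - e2 c.1 + G c.2.2.1, e1 c.1 + G c.2.2.2,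
    h23 c.1 + z2 c.2.1 + z3 c.2.2.1,
    - h13 c.1 - z1 c.2.1 + z3 c.2.2.2,
    h12 c.1 - z1 c.2.2.1 - z2 c.2.2.2)
  map_add' a b := by
    simp only [Prod.fst_add, Prod.snd_add, map_add, Prod.mk_add_mk, Prod.mk.injEq]
    refine ⟨?_, ?_, ?_, ?_, ?_, ?_⟩ <;> abel
  map_smul' r a := by
    simp [smul_sub, smul_add]

def dd4 (G z1 z2 z3 : M →ₗ[R] M) : M →ₗ[R] (M × M × M × M) where
  toFun g := (G g, - z3 g, z2 g, - z1 g)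
  map_add' a b := by
    simp only [map_add, neg_add, Prod.mk_add_mk]
  map_smul' r a := by
    simp

/-- The relations among the operators. -/
structure Rels (G e1 e2 e3 z1 z2 z3 h12 h13 h23 : M →ₗ[R] M) : Prop where
  inj : Function.Injective G
  c1 : ∀ v, G (z1 v) = e1 (G v)
  c2 : ∀ v, G (z2 v) = e2 (G v)
  c3 : ∀ v, G (z3 v) = e3 (G v)
  k12 : ∀ v, e1 (e2 v) = e2 (e1 v) + G (h12 v)
  k13 : ∀ v, e1 (e3 v) = e3 (e1 v) + G (h13 v)
  k23 : ∀ v, e2 (e3 v) = e3 (e2 v) + G (h23 v)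
  r1 : ∀ v a, e1 v = G a → ∃ b, v = G b
  r2 : ∀ v a b, e2 v = G a + e1 b → ∃ a b, v = G a + e1 b
  r3 : ∀ v a b c, e3 v = G a + e1 b + e2 c → ∃ a b c, v = G a + e1 b + e2 c

variable {G e1 e2 e3 z1 z2 z3 h12 h13 h23 : M →ₗ[R] M}

theorem Rels.l12 (h : Rels G e1 e2 e3 z1 z2 z3 h12 h13 h23) (v : M) :
    z1 (z2 v) = z2 (z1 v) + h12 (G v) := by
  apply h.inj; simp only [map_add, h.c1, h.c2, h.k12]
theorem Rels.l13 (h : Rels G e1 e2 e3 z1 z2 z3 h12 h13 h23) (v : M) :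
    z1 (z3 v) = z3 (z1 v) + h13 (G v) := by
  apply h.inj; simp only [map_add, h.c1, h.c3, h.k13]
theorem Rels.l23 (h : Rels G e1 e2 e3 z1 z2 z3 h12 h13 h23) (v : M) :
    z2 (z3 v) = z3 (z2 v) + h23 (G v) := by
  apply h.inj; simp only [map_add, h.c2, h.c3, h.k23]
theorem Rels.jac (h : Rels G e1 e2 e3 z1 z2 z3 h12 h13 h23) (v : M) :
    - z1 (h23 v) + z2 (h13 v) - z3 (h12 v) + h12 (e3 v) - h13 (e2 v) + h23 (e1 v) = 0 := by
  apply h.inj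
  have a1 := h.k12 (e3 v)
  have a2 := h.k13 (e2 v)
  have a3 := h.k23 (e1 v)
  have b1 := congrArg e3 (h.k12 v)
  have b2 := congrArg e2 (h.k13 v)
  have b3 := congrArg e1 (h.k23 v)
  simp only [map_add, map_sub, map_neg, map_zero, h.c1, h.c2, h.c3] at *
  linear_combination (norm := module) -a1 + a2 - a3 + b3 - b2 + b1

theorem Rels.dd12 (h : Rels G e1 e2 e3 z1 z2 z3 h12 h13 h23) (c) :
    dd1 G e1 e2 e3 (dd2 G e1 e2 e3 z1 z2 z3 h12 h13 h23 c) = 0 := by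
  obtain ⟨a, b, c, d, e, f⟩ := c
  simp only [dd1, dd2, LinearMap.coe_mk, AddHom.coe_mk, map_add, map_sub, map_neg, h.c1, h.c2,
    h.c3, h.k12, h.k13, h.k23]
  abel
theorem Rels.dd23 (h : Rels G e1 e2 e3 z1 z2 z3 h12 h13 h23) (c) :
    dd2 G e1 e2 e3 z1 z2 z3 h12 h13 h23 (dd3 G e1 e2 e3 z1 z2 z3 h12 h13 h23 c) = 0 := by
  obtain ⟨a, b, c, d⟩ := c
  have j := h.jac a
  simp only [dd3, dd2, LinearMap.coe_mk, AddHom.coe_mk, map_add, map_sub, map_neg, h.c1, h.c2,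
    h.c3, h.k12, h.k13, h.k23, h.l12, h.l13, h.l23, Prod.mk_eq_zero]
  refine ⟨by abel, by abel, by abel, ?_⟩
  rw [← j]; abel
theorem Rels.dd34 (h : Rels G e1 e2 e3 z1 z2 z3 h12 h13 h23) (c) :
    dd3 G e1 e2 e3 z1 z2 z3 h12 h13 h23 (dd4 G z1 z2 z3 c) = 0 := by
  simp only [dd3, dd4, LinearMap.coe_mk, AddHom.coe_mk, map_add, map_sub, map_neg, h.c1, h.c2,
    h.c3, h.k12, h.k13, h.k23, h.l12, h.l13, h.l23, Prod.mk_eq_zero]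
  refine ⟨by abel, by abel, by abel, by abel, by abel, by abel⟩

theorem Rels.ex1 (h : Rels G e1 e2 e3 z1 z2 z3 h12 h13 h23) (c)
    (hc : dd1 G e1 e2 e3 c = 0) : ∃ b, dd2 G e1 e2 e3 z1 z2 z3 h12 h13 h23 b = c := by
  obtain ⟨m1, m2, m3, g⟩ := c
  have hc0 : e1 m1 + e2 m2 + e3 m3 + G g = 0 := hc
  obtain ⟨a, b, c, rfl⟩ := h.r3 m3 (-g) (-m1) (-m2) (by
    simp only [map_neg]; rw [← sub_eq_zero, ← hc0]; abel)
  obtain ⟨a', b', hm2⟩ := h.r2 (m2 + e3 c) (-g - z3 a + h13 b + h23 c) (-m1 - e3 b) (by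
    rw [← sub_eq_zero, ← hc0]
    simp only [map_add, map_sub, map_neg, map_zero, h.c3, h.k13, h.k23]; abel)
  have hm2' : m2 = G a' + e1 b' - e3 c := by rw [← hm2]; abel
  subst hm2'
  obtain ⟨a'', hm1⟩ := h.r1 (m1 + e3 b + e2 b') (-g - z3 a + h13 b + h23 c - z2 a' + h12 b') (by
    rw [← sub_eq_zero, ← hc0]
    simp only [map_add, map_sub, map_neg, map_zero, h.c2, h.c3, h.k13, h.k23, h.k12]; abel)
  have hm1' : m1 = G a'' - e3 b - e2 b' := by rw [← hm1]; abel
  subst hm1'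
  refine ⟨(b', b, c, a'', a', a), ?_⟩
  have hg : - z1 a'' - z2 a' - z3 a + h12 b' + h13 b + h23 c = g := by
    apply h.inj
    rw [← sub_eq_zero, ← neg_eq_zero, ← hc0]
    simp only [map_add, map_sub, map_neg, map_zero, h.c1, h.c2, h.c3, h.k13, h.k23, h.k12]; abel
  simp only [dd2, LinearMap.coe_mk, AddHom.coe_mk, hg, Prod.mk.injEq, and_true]
  refine ⟨by abel, by abel, by abel⟩

theorem Rels.ex2 (h : Rels G e1 e2 e3 z1 z2 z3 h12 h13 h23) (c)
    (hc : dd2 G e1 e2 e3 z1 z2 z3 h12 h13 h23 c = 0) :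
    ∃ b, dd3 G e1 e2 e3 z1 z2 z3 h12 h13 h23 b = c := by
  -- successive subtraction
  have key : ∀ m12 m13 m23 g1 g2 g3 : M,
      dd2 G e1 e2 e3 z1 z2 z3 h12 h13 h23 (m12, m13, m23, g1, g2, g3) = 0 →
      (- e2 m12 - e3 m13 + G g1 = 0 ∧ e1 m12 - e3 m23 + G g2 = 0 ∧
        e1 m13 + e2 m23 + G g3 = 0) := by
    intro m12 m13 m23 g1 g2 g3 hh
    simp only [dd2, LinearMap.coe_mk, AddHom.coe_mk, Prod.mk_eq_zero] at hh
    exact ⟨hh.1, hh.2.1, hh.2.2.1⟩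
  have st1 : ∃ b c', c = dd3 G e1 e2 e3 z1 z2 z3 h12 h13 h23 b + c' ∧ c'.2.2.1 = 0 := by
    obtain ⟨m12, m13, m23, g1, g2, g3⟩ := c
    obtain ⟨-, -, k3⟩ := key _ _ _ _ _ _ hc
    obtain ⟨a, b, hm⟩ := h.r2 m23 (-g3) (-m13) (by
      simp only [map_neg]; rw [← sub_eq_zero, ← k3]; abel)
    refine ⟨(b, 0, 0, a), _, (add_sub_cancel _ _).symm, ?_⟩
    simp [dd3, hm]; abel
  obtain ⟨b1, c1, rfl, h1⟩ := st1
  rw [map_add, h.dd23, zero_add] at hc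
  have st2 : ∃ b c', c1 = dd3 G e1 e2 e3 z1 z2 z3 h12 h13 h23 b + c' ∧ c'.2.2.1 = 0 ∧
      c'.2.1 = 0 := by
    obtain ⟨m12, m13, m23, g1, g2, g3⟩ := c1
    obtain ⟨-, -, k3⟩ := key _ _ _ _ _ _ hc
    simp only at h1; subst h1
    obtain ⟨a, hm⟩ := h.r1 m13 (-g3) (by
      simp only [map_neg]; rw [← sub_eq_zero, ← k3, map_zero]; abel)
    refine ⟨(0, 0, a, 0), _, (add_sub_cancel _ _).symm, ?_⟩
    simp [dd3, hm]
  obtain ⟨b2, c2, rfl, h2, h2'⟩ := st2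
  rw [map_add, h.dd23, zero_add] at hc
  obtain ⟨m12, m13, m23, g1, g2, g3⟩ := c2
  simp only at h2 h2'; subst h2; subst h2'
  obtain ⟨k1, k2, k3⟩ := key _ _ _ _ _ _ hc
  obtain ⟨a, hm⟩ := h.r1 m12 (-g2) (by
      simp only [map_neg]; rw [← sub_eq_zero, ← k2, map_zero]; abel)
  subst hm
  have e3' : g3 = 0 := by apply h.inj; simpa using k3
  have e2' : g2 = - z1 a := by
    apply h.inj; rw [map_neg, h.c1, ← sub_eq_zero, ← k2, map_zero]; abel
  have e1' : g1 = z2 a := by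
    apply h.inj; rw [h.c2, ← sub_eq_zero, ← k1, map_zero]; abel
  subst e3' e2' e1'
  refine ⟨b1 + (b2 + (0, a, 0, 0)), ?_⟩
  rw [map_add, map_add]
  congr 2
  simp [dd3]

theorem Rels.ex3 (h : Rels G e1 e2 e3 z1 z2 z3 h12 h13 h23) (c)
    (hc : dd3 G e1 e2 e3 z1 z2 z3 h12 h13 h23 c = 0) :
    ∃ b, dd4 G z1 z2 z3 b = c := by
  obtain ⟨m, g12, g13, g23⟩ := c
  simp only [dd3, LinearMap.coe_mk, AddHom.coe_mk, Prod.mk_eq_zero] at hc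
  obtain ⟨k1, k2, k3, -⟩ := hc
  obtain ⟨a, rfl⟩ := h.r1 m (-g23) (by
      simp only [map_neg]; rw [← sub_eq_zero, ← k3]; abel)
  refine ⟨a, ?_⟩
  simp only [dd4, LinearMap.coe_mk, AddHom.coe_mk, Prod.mk.injEq, true_and]
  refine ⟨?_, ?_, ?_⟩
  · apply h.inj; rw [map_neg, h.c3, ← sub_eq_zero, ← neg_eq_zero, ← k1]; abel
  · apply h.inj; rw [h.c2, ← sub_eq_zero, ← neg_eq_zero, ← k2]; abel
  · apply h.inj; rw [map_neg, h.c1, ← sub_eq_zero, ← neg_eq_zero, ← k3]; abel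
end AbstractChase
section Elim
set_option linter.unusedSimpArgs false
variable {R : Type*} [CommRing R]

theorem transport_exact {K1 K2 K3 F1 F2 F3 : Type*} [AddCommGroup K1] [AddCommGroup K2]
    [AddCommGroup K3] [AddCommGroup F1] [AddCommGroup F2] [AddCommGroup F3]
    [Module R K1] [Module R K2] [Module R K3] [Module R F1] [Module R F2] [Module R F3]
    (E1 : K1 ≃ₗ[R] F1) (E2 : K2 ≃ₗ[R] F2) (E3 : K3 ≃ₗ[R] F3)
    (d1 : K1 →ₗ[R] K2) (d2 : K2 →ₗ[R] K3)
    (h : ∀ x, d2 x = 0 ↔ ∃ y, d1 y = x) :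
    LinearMap.range (E2.toLinearMap ∘ₗ d1 ∘ₗ E1.symm.toLinearMap) =
      LinearMap.ker (E3.toLinearMap ∘ₗ d2 ∘ₗ E2.symm.toLinearMap) := by
  ext x
  simp only [LinearMap.mem_range, LinearMap.mem_ker, LinearMap.comp_apply,
    LinearEquiv.coe_coe, LinearEquiv.map_eq_zero_iff, h]
  constructor
  · rintro ⟨y, rfl⟩
    exact ⟨E1.symm y, by simp⟩
  · rintro ⟨y, hy⟩
    exact ⟨E1 y, by simp [hy]⟩

/-- Coordinate conditions on the operators. -/
structure Slots (e1 e2 e3 z1 z2 z3 h12 h13 h23 : (Fin 4 → R) →ₗ[R] (Fin 4 → R))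
    (y1 y2 y3 : R) : Prop where
  s1 : ∀ t, ∀ a : Fin 4, a ≠ 0 → e1 (Pi.single 0 t) a = if a = 1 then -t else 0
  s2 : ∀ t, ∀ a : Fin 4, a ≠ 0 → e2 (Pi.single 0 t) a = if a = 2 then -t else 0
  s3 : ∀ t, ∀ a : Fin 4, a ≠ 0 → e3 (Pi.single 0 t) a = if a = 3 then -t else 0
  t1 : ∀ g, z1 g 0 = y1 * g 0 - g 1
  t2 : ∀ g, z2 g 0 = y2 * g 0 - g 2
  t3 : ∀ g, z3 g 0 = y3 * g 0 - g 3
  u12 : ∀ v, h12 v 0 = 0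
  u13 : ∀ v, h13 v 0 = 0
  u23 : ∀ v, h23 v 0 = 0


def bb0 : Submodule R (Fin 4 → R) where
  carrier := {c | c 1 = 0 ∧ c 2 = 0 ∧ c 3 = 0}
  add_mem' := by rintro a b ⟨h1, h2, h3⟩ ⟨h4, h5, h6⟩; simp [*]
  zero_mem' := by simp
  smul_mem' := by rintro r a ⟨h1, h2, h3⟩; simp [*]

def bb1 : Submodule R ((Fin 4 → R) × (Fin 4 → R) × (Fin 4 → R) × (Fin 4 → R)) where
  carrier := {c | c.2.1 1 = 0 ∧ c.2.2.1 1 = 0 ∧ c.2.2.1 2 = 0 ∧ c.2.2.2 0 = 0}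
  add_mem' := by rintro a b ⟨h1, h2, h3, h7⟩ ⟨h4, h5, h6, h8⟩; simp [*]
  zero_mem' := by simp
  smul_mem' := by rintro r a ⟨h1, h2, h3, h4⟩; simp [*]

def bb2 : Submodule R ((Fin 4 → R) × (Fin 4 → R) × (Fin 4 → R) × (Fin 4 → R) × (Fin 4 → R) × (Fin 4 → R)) where
  carrier := {c | c.2.2.1 1 = 0 ∧ c.2.2.2.1 0 = 0 ∧ c.2.2.2.2.1 0 = 0 ∧ c.2.2.2.2.2 0 = 0}
  add_mem' := by rintro a b ⟨h1, h2, h3, h7⟩ ⟨h4, h5, h6, h8⟩; simp [*]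
  zero_mem' := by simp
  smul_mem' := by rintro r a ⟨h1, h2, h3, h4⟩; simp [*]

def bb3 : Submodule R ((Fin 4 → R) × (Fin 4 → R) × (Fin 4 → R) × (Fin 4 → R)) where
  carrier := {c | c.2.1 0 = 0 ∧ c.2.2.1 0 = 0 ∧ c.2.2.2 0 = 0}
  add_mem' := by rintro a b ⟨h1, h2, h3⟩ ⟨h4, h5, h6⟩; simp [*]
  zero_mem' := by simp
  smul_mem' := by rintro r a ⟨h1, h2, h3⟩; simp [*]

def rr1 : ((Fin 4 → R) × (Fin 4 → R) × (Fin 4 → R) × (Fin 4 → R)) →ₗ[R] (Fin 9 → R) where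
  toFun c := ![c.1 1, c.1 2, c.1 3, c.2.1 2, c.2.1 3, c.2.2.1 3, c.2.2.2 1, c.2.2.2 2, c.2.2.2 3]
  map_add' a b := by simp
  map_smul' r a := by simp

def rr2 : ((Fin 4 → R) × (Fin 4 → R) × (Fin 4 → R) × (Fin 4 → R) × (Fin 4 → R) × (Fin 4 → R)) →ₗ[R] (Fin 16 → R) where
  toFun c := ![c.1 1, c.1 2, c.1 3, c.2.1 1, c.2.1 2, c.2.1 3, c.2.2.1 2, c.2.2.1 3,
    c.2.2.2.1 2, c.2.2.2.1 3, c.2.2.2.2.1 1, c.2.2.2.2.1 2, c.2.2.2.2.1 3,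
    c.2.2.2.2.2 1, c.2.2.2.2.2 2, c.2.2.2.2.2 3]
  map_add' a b := by simp
  map_smul' r a := by simp

def rr3 : ((Fin 4 → R) × (Fin 4 → R) × (Fin 4 → R) × (Fin 4 → R)) →ₗ[R] (Fin 9 → R) where
  toFun c := ![c.1 1, c.1 2, c.1 3, c.2.1 3, c.2.2.1 2, c.2.2.1 3, c.2.2.2 1, c.2.2.2 2, c.2.2.2 3]
  map_add' a b := by simp
  map_smul' r a := by simp

theorem eq_single0 (m : (Fin 4 → R)) (h1 : m 1 = 0) (h2 : m 2 = 0) (h3 : m 3 = 0) :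
    m = Pi.single 0 (m 0) := by
  ext i; fin_cases i <;> simp [h1, h2, h3]

variable {G e1 e2 e3 z1 z2 z3 h12 h13 h23 : (Fin 4 → R) →ₗ[R] (Fin 4 → R)} {y1 y2 y3 : R}


theorem bij1 (s : Slots e1 e2 e3 z1 z2 z3 h12 h13 h23 y1 y2 y3) : Function.Bijective ((rr1 (R := R)).domRestrict
    (bb1 ⊓ Submodule.comap (dd1 G e1 e2 e3) bb0)) := by
  constructor
  · rw [← LinearMap.ker_eq_bot, LinearMap.ker_eq_bot']
    rintro ⟨⟨m1, m2, m3, g⟩, ⟨a1, a2, a3, a4⟩, a5, a6, a7⟩ hr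
    apply Subtype.ext
    rw [Submodule.coe_zero]
    dsimp only
    simp only at a1 a2 a3 a4
    simp only [rr1, LinearMap.domRestrict_apply, LinearMap.coe_mk, AddHom.coe_mk] at hr
    have q := fun i => congrFun hr i
    have q0 : m1 1 = 0 := q 0
    have q1 : m1 2 = 0 := q 1
    have q2 : m1 3 = 0 := q 2
    have q3 : m2 2 = 0 := q 3
    have q4 : m2 3 = 0 := q 4
    have q5 : m3 3 = 0 := q 5
    have q6 : g 1 = 0 := q 6
    have q7 : g 2 = 0 := q 7
    have q8 : g 3 = 0 := q 8
    have w1 := eq_single0 m1 q0 q1 q2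
    have w2 := eq_single0 m2 a1 q3 q4
    have w3 := eq_single0 m3 a2 a3 q5
    have w4 := eq_single0 g q6 q7 q8
    rw [a4, Pi.single_zero] at w4
    simp only [dd1, LinearMap.coe_mk, AddHom.coe_mk] at a5 a6 a7
    rw [w1, w2, w3, w4] at a5 a6 a7
    simp [s.s1, s.s2, s.s3] at a5 a6 a7
    rw [w1, w2, w3, w4, a5, a6, a7]
    simp
  · intro u
    let c0 : (Fin 4 → R) × (Fin 4 → R) × (Fin 4 → R) × (Fin 4 → R) := (![0, u 0, u 1, u 2], ![0, 0, u 3, u 4], ![0, 0, 0, u 5],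
      ![0, u 6, u 7, u 8])
    let v := dd1 G e1 e2 e3 c0
    refine ⟨⟨c0 + (Pi.single 0 (v 1), Pi.single 0 (v 2), Pi.single 0 (v 3), 0), ⟨?_, ?_⟩⟩, ?_⟩
    · simp [bb1, c0, Matrix.vecHead, Matrix.vecTail]
    · change dd1 G e1 e2 e3 _ ∈ bb0
      rw [map_add]
      refine ⟨?_, ?_, ?_⟩ <;> rw [Pi.add_apply] <;> change v _ + _ = 0 <;>
        simp [dd1, s.s1, s.s2, s.s3]
    · ext i
      fin_cases i <;> simp [rr1, c0, Matrix.vecHead, Matrix.vecTail]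

theorem bij2 (s : Slots e1 e2 e3 z1 z2 z3 h12 h13 h23 y1 y2 y3) : Function.Bijective ((rr2 (R := R)).domRestrict
    (bb2 ⊓ Submodule.comap (dd2 G e1 e2 e3 z1 z2 z3 h12 h13 h23) bb1)) := by
  constructor
  · rw [← LinearMap.ker_eq_bot, LinearMap.ker_eq_bot']
    rintro ⟨⟨m1, m2, m3, g1, g2, g3⟩, ⟨a1, a2, a3, a4⟩, a5, a6, a7, a8⟩ hr
    apply Subtype.ext
    rw [Submodule.coe_zero]
    dsimp only
    simp only at a1 a2 a3 a4
    simp only [rr2, LinearMap.domRestrict_apply, LinearMap.coe_mk, AddHom.coe_mk] at hr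
    have q := fun i => congrFun hr i
    have q0 : m1 1 = 0 := q 0
    have q1 : m1 2 = 0 := q 1
    have q2 : m1 3 = 0 := q 2
    have q3 : m2 1 = 0 := q 3
    have q4 : m2 2 = 0 := q 4
    have q5 : m2 3 = 0 := q 5
    have q6 : m3 2 = 0 := q 6
    have q7 : m3 3 = 0 := q 7
    have q8 : g1 2 = 0 := q 8
    have q9 : g1 3 = 0 := q 9
    have q10 : g2 1 = 0 := q 10
    have q11 : g2 2 = 0 := q 11
    have q12 : g2 3 = 0 := q 12
    have q13 : g3 1 = 0 := q 13
    have q14 : g3 2 = 0 := q 14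
    have q15 : g3 3 = 0 := q 15
    have w1 := eq_single0 m1 q0 q1 q2
    have w2 := eq_single0 m2 q3 q4 q5
    have w3 := eq_single0 m3 a1 q6 q7
    have w5 := eq_single0 g2 q10 q11 q12
    have w6 := eq_single0 g3 q13 q14 q15
    simp only [dd2, LinearMap.coe_mk, AddHom.coe_mk] at a5 a6 a7 a8
    rw [a3, Pi.single_zero] at w5
    rw [a4, Pi.single_zero] at w6
    rw [w5, w6] at a8
    simp [s.t1, s.t2, s.t3, s.u12, s.u13, s.u23, a2] at a8
    have w4 := eq_single0 g1 a8 q8 q9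
    rw [a2, Pi.single_zero] at w4
    rw [w1, w3, w5] at a5
    rw [w2, w3, w6] at a6 a7
    simp [s.s1, s.s2, s.s3] at a5 a6 a7
    rw [w1, w2, w3, w4, w5, w6, a5, a6, a7]
    simp
  · intro u
    let c0 : (Fin 4 → R) × (Fin 4 → R) × (Fin 4 → R) × (Fin 4 → R) × (Fin 4 → R) × (Fin 4 → R) := (![0, u 0, u 1, u 2], ![0, u 3, u 4, u 5],
      ![0, 0, u 6, u 7], ![0, 0, u 8, u 9], ![0, u 10, u 11, u 12], ![0, u 13, u 14, u 15])
    let v := dd2 G e1 e2 e3 z1 z2 z3 h12 h13 h23 c0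
    let c1 : (Fin 4 → R) × (Fin 4 → R) × (Fin 4 → R) × (Fin 4 → R) × (Fin 4 → R) × (Fin 4 → R) := c0 + (0, 0, 0, Pi.single 1 (- v.2.2.2 0), 0, 0)
    let v1 := dd2 G e1 e2 e3 z1 z2 z3 h12 h13 h23 c1
    have hv1 : v1.2.2.2 0 = 0 := by
      simp only [v1, c1, map_add]
      rw [Prod.snd_add, Prod.snd_add, Prod.snd_add, Pi.add_apply]
      change v.2.2.2 0 + _ = 0
      simp [dd2, s.t1]
    refine ⟨⟨c1 + (Pi.single 0 (v1.2.1 1), Pi.single 0 (v1.2.2.1 1), Pi.single 0 (v1.2.2.1 2),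
      0, 0, 0), ⟨?_, ?_⟩⟩, ?_⟩
    · simp [bb2, c0, c1, Matrix.vecHead, Matrix.vecTail]
    · change dd2 G e1 e2 e3 z1 z2 z3 h12 h13 h23 _ ∈ bb1
      rw [map_add]
      change v1 + _ ∈ _
      refine ⟨?_, ?_, ?_, ?_⟩ <;>
        simp [dd2, s.s1, s.s2, s.s3, s.u12, s.u13, s.u23, hv1]
    · ext i
      fin_cases i <;> simp [rr2, c0, c1, Matrix.vecHead, Matrix.vecTail]

theorem bij3 (s : Slots e1 e2 e3 z1 z2 z3 h12 h13 h23 y1 y2 y3) : Function.Bijective ((rr3 (R := R)).domRestrict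
    (bb3 ⊓ Submodule.comap (dd3 G e1 e2 e3 z1 z2 z3 h12 h13 h23) bb2)) := by
  constructor
  · rw [← LinearMap.ker_eq_bot, LinearMap.ker_eq_bot']
    rintro ⟨⟨m, g12, g13, g23⟩, ⟨a1, a2, a3⟩, a5, a6, a7, a8⟩ hr
    apply Subtype.ext
    rw [Submodule.coe_zero]
    dsimp only
    simp only at a1 a2 a3
    simp only [rr3, LinearMap.domRestrict_apply, LinearMap.coe_mk, AddHom.coe_mk] at hr
    have q := fun i => congrFun hr i
    have q0 : m 1 = 0 := q 0
    have q1 : m 2 = 0 := q 1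
    have q2 : m 3 = 0 := q 2
    have q3 : g12 3 = 0 := q 3
    have q4 : g13 2 = 0 := q 4
    have q5 : g13 3 = 0 := q 5
    have q6 : g23 1 = 0 := q 6
    have q7 : g23 2 = 0 := q 7
    have q8 : g23 3 = 0 := q 8
    have w1 := eq_single0 m q0 q1 q2
    have w4 := eq_single0 g23 q6 q7 q8
    rw [a3, Pi.single_zero] at w4
    simp only [dd3, LinearMap.coe_mk, AddHom.coe_mk] at a5 a6 a7 a8
    simp [s.t1, s.t2, s.t3, s.u12, s.u13, s.u23, a1, a2, a3, q3, q4, q5, q6, q7, q8] at a6 a7 a8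
    have w2 := eq_single0 g12 a7 a6 q3
    have w3 := eq_single0 g13 a8 q4 q5
    rw [a1, Pi.single_zero] at w2
    rw [a2, Pi.single_zero] at w3
    rw [w1, w4] at a5
    simp [s.s1, s.s2, s.s3] at a5
    rw [w1, w2, w3, w4, a5]
    simp
  · intro u
    let c0 : (Fin 4 → R) × (Fin 4 → R) × (Fin 4 → R) × (Fin 4 → R) := (![0, u 0, u 1, u 2], ![0, u 8, -u 5, u 3], ![0, -u 7, u 4, u 5],
      ![0, u 6, u 7, u 8])
    let v := dd3 G e1 e2 e3 z1 z2 z3 h12 h13 h23 c0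
    refine ⟨⟨c0 + (Pi.single 0 (v.2.2.1 1), 0, 0, 0), ⟨?_, ?_⟩⟩, ?_⟩
    · simp [bb3, c0, Matrix.vecHead, Matrix.vecTail]
    · change dd3 G e1 e2 e3 z1 z2 z3 h12 h13 h23 _ ∈ bb2
      rw [map_add]
      refine ⟨?_, ?_, ?_, ?_⟩
      · rw [Prod.snd_add, Prod.snd_add, Prod.fst_add, Pi.add_apply]
        change v.2.2.1 1 + _ = 0
        simp [dd3, s.s1]
      all_goals simp [dd3, c0, s.t1, s.t2, s.t3, s.u12, s.u13, s.u23, Matrix.vecHead, Matrix.vecTail]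
    · ext i
      fin_cases i <;> simp [rr3, c0, Matrix.vecHead, Matrix.vecTail]

theorem bij4 (s : Slots e1 e2 e3 z1 z2 z3 h12 h13 h23 y1 y2 y3) : Function.Bijective ((LinearMap.proj 0 : (Fin 4 → R) →ₗ[R] R).domRestrict
    (Submodule.comap (dd4 G z1 z2 z3) bb3)) := by
  constructor
  · rw [← LinearMap.ker_eq_bot, LinearMap.ker_eq_bot']
    rintro ⟨g, a1, a2, a3⟩ hr
    apply Subtype.ext
    rw [Submodule.coe_zero]
    dsimp only
    have q : g 0 = 0 := hr
    simp [dd4, s.t1, s.t2, s.t3, q] at a1 a2 a3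
    rw [eq_single0 g a3 a2 a1, q, Pi.single_zero]
  · intro u
    refine ⟨⟨![u, y1 * u, y2 * u, y3 * u], ?_⟩, ?_⟩
    · refine ⟨?_, ?_, ?_⟩ <;> simp [dd4, s.t1, s.t2, s.t3]
    · simp

theorem adj1 (s : Slots e1 e2 e3 z1 z2 z3 h12 h13 h23 y1 y2 y3) (b : (Fin 4 → R) × (Fin 4 → R) × (Fin 4 → R) × (Fin 4 → R)) :
    ∃ z, b - dd2 G e1 e2 e3 z1 z2 z3 h12 h13 h23 z ∈ bb1 := by
  refine ⟨(Pi.single 0 (- b.2.1 1), Pi.single 0 (- b.2.2.1 1), Pi.single 0 (- b.2.2.1 2),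
    Pi.single 1 (b.2.2.2 0), 0, 0), ?_, ?_, ?_, ?_⟩
  · simp [dd2, s.s1, s.s2, s.s3]
  · simp [dd2, s.s1, s.s2, s.s3]
  · simp [dd2, s.s1, s.s2, s.s3]
  · simp [dd2, s.t1, s.u12, s.u13, s.u23]

theorem adj2 (s : Slots e1 e2 e3 z1 z2 z3 h12 h13 h23 y1 y2 y3) (b : (Fin 4 → R) × (Fin 4 → R) × (Fin 4 → R) × (Fin 4 → R) × (Fin 4 → R) × (Fin 4 → R)) :
    ∃ z, b - dd3 G e1 e2 e3 z1 z2 z3 h12 h13 h23 z ∈ bb2 := by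
  refine ⟨(Pi.single 0 (- b.2.2.1 1), ![0, b.2.2.2.2.1 0, - b.2.2.2.1 0, 0],
    ![0, b.2.2.2.2.2 0, 0, 0], 0), ?_, ?_, ?_, ?_⟩
  · simp [dd3, s.s1]
  all_goals simp [dd3, s.t1, s.t2, s.t3, s.u12, s.u13, s.u23]

theorem adj3 (s : Slots e1 e2 e3 z1 z2 z3 h12 h13 h23 y1 y2 y3) (b : (Fin 4 → R) × (Fin 4 → R) × (Fin 4 → R) × (Fin 4 → R)) :
    ∃ z, b - dd4 G z1 z2 z3 z ∈ bb3 := by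
  refine ⟨![0, b.2.2.2 0, - b.2.2.1 0, b.2.1 0], ?_, ?_, ?_⟩
  all_goals simp [dd4, s.t1, s.t2, s.t3]


theorem bij0 : Function.Bijective ((LinearMap.proj 0 : (Fin 4 → R) →ₗ[R] R).domRestrict bb0) := by
  constructor
  · rw [← LinearMap.ker_eq_bot, LinearMap.ker_eq_bot']
    rintro ⟨g, a1, a2, a3⟩ hr
    apply Subtype.ext
    rw [Submodule.coe_zero]
    dsimp only
    have q : g 0 = 0 := hr
    rw [eq_single0 g a1 a2 a3, q, Pi.single_zero]
  · intro u
    exact ⟨⟨Pi.single 0 u, by simp [bb0]⟩, by simp⟩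

theorem elim_main (h : Rels G e1 e2 e3 z1 z2 z3 h12 h13 h23)
    (s : Slots e1 e2 e3 z1 z2 z3 h12 h13 h23 y1 y2 y3) :
    ∃ (f₄ : R →ₗ[R] (Fin 9 → R)) (f₃ : (Fin 9 → R) →ₗ[R] (Fin 16 → R))
      (f₂ : (Fin 16 → R) →ₗ[R] (Fin 9 → R)) (f₁ : (Fin 9 → R) →ₗ[R] R),
      Function.Injective f₄ ∧ LinearMap.range f₄ = LinearMap.ker f₃ ∧
        LinearMap.range f₃ = LinearMap.ker f₂ ∧ LinearMap.range f₂ = LinearMap.ker f₁ ∧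
        ∀ p, p ∈ LinearMap.range f₁ ↔ ∃ c, dd1 G e1 e2 e3 c = Pi.single (M := fun _ => R) 0 p := by
  let E0 := LinearEquiv.ofBijective _ (bij0 (R := R))
  let E1 := LinearEquiv.ofBijective _ (bij1 (G := G) s)
  let E2 := LinearEquiv.ofBijective _ (bij2 (G := G) s)
  let E3 := LinearEquiv.ofBijective _ (bij3 (G := G) s)
  let E4 := LinearEquiv.ofBijective _ (bij4 (G := G) s)
  let d1 := (dd1 G e1 e2 e3).restrict (p := bb1 ⊓ Submodule.comap (dd1 G e1 e2 e3) bb0)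
    (q := bb0) (fun x hx => hx.2)
  let d2 := (dd2 G e1 e2 e3 z1 z2 z3 h12 h13 h23).restrict
    (p := bb2 ⊓ Submodule.comap (dd2 G e1 e2 e3 z1 z2 z3 h12 h13 h23) bb1)
    (q := bb1 ⊓ Submodule.comap (dd1 G e1 e2 e3) bb0)
    (fun x hx => ⟨hx.2, by change dd1 G e1 e2 e3 _ ∈ bb0; rw [h.dd12]; exact zero_mem _⟩)
  let d3 := (dd3 G e1 e2 e3 z1 z2 z3 h12 h13 h23).restrict
    (p := bb3 ⊓ Submodule.comap (dd3 G e1 e2 e3 z1 z2 z3 h12 h13 h23) bb2)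
    (q := bb2 ⊓ Submodule.comap (dd2 G e1 e2 e3 z1 z2 z3 h12 h13 h23) bb1)
    (fun x hx => ⟨hx.2, by change dd2 G e1 e2 e3 z1 z2 z3 h12 h13 h23 _ ∈ bb1; rw [h.dd23]; exact zero_mem _⟩)
  let d4 := (dd4 G z1 z2 z3).restrict
    (p := Submodule.comap (dd4 G z1 z2 z3) bb3)
    (q := bb3 ⊓ Submodule.comap (dd3 G e1 e2 e3 z1 z2 z3 h12 h13 h23) bb2)
    (fun x hx => ⟨hx, by change dd3 G e1 e2 e3 z1 z2 z3 h12 h13 h23 _ ∈ bb2; rw [h.dd34]; exact zero_mem _⟩)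
  refine ⟨E3.toLinearMap ∘ₗ d4 ∘ₗ E4.symm.toLinearMap, E2.toLinearMap ∘ₗ d3 ∘ₗ E3.symm.toLinearMap,
    E1.toLinearMap ∘ₗ d2 ∘ₗ E2.symm.toLinearMap, E0.toLinearMap ∘ₗ d1 ∘ₗ E1.symm.toLinearMap,
    ?_, ?_, ?_, ?_, ?_⟩
  · intro a b hab
    have hab' := E3.injective hab
    have : G (E4.symm a).1 = G (E4.symm b).1 := congrArg (fun c => c.1.1) hab'
    exact E4.symm.injective (Subtype.ext (h.inj this))
  · apply transport_exact
    rintro ⟨x, hx⟩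
    constructor
    · intro hx0
      obtain ⟨b, hb⟩ := h.ex3 x (congrArg Subtype.val hx0)
      exact ⟨⟨b, by rw [Submodule.mem_comap, hb]; exact hx.1⟩, Subtype.ext hb⟩
    · rintro ⟨b, hb⟩
      rw [← hb]; exact Subtype.ext (h.dd34 _)
  · apply transport_exact
    rintro ⟨x, hx⟩
    constructor
    · intro hx0
      obtain ⟨b, hb⟩ := h.ex2 x (congrArg Subtype.val hx0)
      obtain ⟨z, hz⟩ := adj3 (G := G) s b
      have hb' : dd3 G e1 e2 e3 z1 z2 z3 h12 h13 h23 (b - dd4 G z1 z2 z3 z) = x := by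
        rw [map_sub, h.dd34, hb, sub_zero]
      exact ⟨⟨_, hz, by change dd3 G e1 e2 e3 z1 z2 z3 h12 h13 h23 _ ∈ bb2; rw [hb']; exact hx.1⟩, Subtype.ext hb'⟩
    · rintro ⟨b, hb⟩
      rw [← hb]; exact Subtype.ext (h.dd23 _)
  · apply transport_exact
    rintro ⟨x, hx⟩
    constructor
    · intro hx0
      obtain ⟨b, hb⟩ := h.ex1 x (congrArg Subtype.val hx0)
      obtain ⟨z, hz⟩ := adj2 (G := G) s b
      have hb' : dd2 G e1 e2 e3 z1 z2 z3 h12 h13 h23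
          (b - dd3 G e1 e2 e3 z1 z2 z3 h12 h13 h23 z) = x := by
        rw [map_sub, h.dd23, hb, sub_zero]
      exact ⟨⟨_, hz, by change dd2 G e1 e2 e3 z1 z2 z3 h12 h13 h23 _ ∈ bb1; rw [hb']; exact hx.1⟩, Subtype.ext hb'⟩
    · rintro ⟨b, hb⟩
      rw [← hb]; exact Subtype.ext (h.dd12 _)
  · intro p
    constructor
    · rintro ⟨u, rfl⟩
      refine ⟨(E1.symm u).1, ?_⟩
      have := (d1 (E1.symm u)).2
      exact eq_single0 _ this.1 this.2.1 this.2.2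
    · rintro ⟨c, hc⟩
      obtain ⟨z, hz⟩ := adj1 (G := G) s c
      have hb' : dd1 G e1 e2 e3 (c - dd2 G e1 e2 e3 z1 z2 z3 h12 h13 h23 z) = Pi.single 0 p := by
        rw [map_sub, h.dd12, hc, sub_zero]
      refine ⟨E1 ⟨_, hz, by change dd1 G e1 e2 e3 _ ∈ bb0; rw [hb']; simp [bb0]⟩, ?_⟩
      simp only [LinearMap.comp_apply, LinearEquiv.coe_coe, LinearEquiv.symm_apply_apply]
      change dd1 G e1 e2 e3 (c - dd2 G e1 e2 e3 z1 z2 z3 h12 h13 h23 z) 0 = p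
      rw [hb']; simp

end Elim
section Mats
variable {R : Type*} [CommRing R]

theorem red_core {M : Type*} [AddCommGroup M] [Module R M] (L : Submodule R M) (t : R)
    (e : M →ₗ[R] M) (σ : M →+ M) (hσL : ∀ v ∈ L, σ v ∈ L) (heL : ∀ v ∈ L, e v ∈ L)
    (hσ : ∀ v, σ (t • v) = v) (hc : ∀ v, σ (t • v - e v) = t • σ v - e (σ v))
    (nil : ∀ v, ∃ n : ℕ, σ^[n] v = 0) (v : M) (hv : e v ∈ L) : v ∈ L := by
  have key : ∀ n : ℕ, ∀ v, v - (t • σ v - e (σ v)) ∈ L → σ^[n] v = 0 → v ∈ L := by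
    intro n
    induction n with
    | zero => intro v _ h; simp at h; rw [h]; exact zero_mem _
    | succ n ih =>
      intro v h1 h2
      have h3 : σ v ∈ L := by
        apply ih (σ v)
        · have := hσL _ h1
          rw [map_sub, hc] at this
          exact this
        · simpa using h2
      have h4 := L.add_mem h1 (L.sub_mem (L.smul_mem t h3) (heL _ h3))
      simpa using h4
  obtain ⟨n, hn⟩ := nil v
  refine key n v ?_ hn
  have h1 := hσL _ hv
  have h2 : e v = t • v - (t • v - e v) := by abel
  rw [h2, map_sub, hσ, hc] at h1
  exact h1

/-- the operator data over a domain -/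
structure MD (x : R) (g : Fin 4 → Matrix (Fin 4) (Fin 4) R) (q : Matrix (Fin 4) (Fin 4) R) :
    Prop where
  x0 : ∀ a b, x * a = x * b → a = b
  sym : ∀ i, (g i).transpose = g i
  sy0 : ∀ i j a, g i a j = g j a i
  qg : q * g 0 = 1
  gq : g 0 * q = 1

def mE (x : R) : Fin 4 → R := fun a => if a = 0 then x ^ 2 else x
def mF (x : R) : Fin 4 → R := fun a => if a = 0 then 1 else x
def mY (x : R) (g : Fin 4 → Matrix (Fin 4) (Fin 4) R) (q : Matrix (Fin 4) (Fin 4) R) (i : Fin 4) :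
    Matrix (Fin 4) (Fin 4) R :=
  Matrix.of fun a b => if b = 0 then (if a = i then 1 else 0) else (q * g i) a b * mE x a
def mG (x : R) (q : Matrix (Fin 4) (Fin 4) R) : Matrix (Fin 4) (Fin 4) R :=
  Matrix.diagonal (mE x) * q * Matrix.diagonal (mE x)
def mH (g : Fin 4 → Matrix (Fin 4) (Fin 4) R) (q : Matrix (Fin 4) (Fin 4) R) (i j : Fin 4) :
    Matrix (Fin 4) (Fin 4) R := g i * q * g j - g j * q * g i

variable {x : R} {g : Fin 4 → Matrix (Fin 4) (Fin 4) R} {q : Matrix (Fin 4) (Fin 4) R}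

theorem MD.cancel (h : MD x g q) (A B : Matrix (Fin 4) (Fin 4) R) (hh : x • A = x • B) : A = B := by
  ext a b
  apply h.x0
  exact congrFun (congrFun hh a) b

theorem MD.qsym (h : MD x g q) : q.transpose = q := by
  have h1 : q.transpose * g 0 = 1 := by
    have := congrArg Matrix.transpose h.gq
    rwa [Matrix.transpose_mul, h.sym, Matrix.transpose_one] at this
  calc q.transpose = q.transpose * (g 0 * q) := by rw [h.gq, mul_one]
    _ = q := by rw [← mul_assoc, h1, one_mul]

theorem MD.col0 (h : MD x g q) (i a : Fin 4) : (q * g i) a 0 = if a = i then 1 else 0 := by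
  have : (q * g 0) a i = (1 : Matrix (Fin 4) (Fin 4) R) a i := by rw [h.qg]
  rw [Matrix.one_apply] at this
  rw [← this, Matrix.mul_apply, Matrix.mul_apply]
  exact Finset.sum_congr rfl fun c _ => by rw [h.sy0 i 0]

theorem MD.xY (h : MD x g q) (i : Fin 4) (hi : i ≠ 0) :
    x • mY x g q i = Matrix.diagonal (mE x) * (q * g i) * Matrix.diagonal (mF x) := by
  ext a b
  rw [Matrix.mul_diagonal, Matrix.diagonal_mul, Matrix.smul_apply, mY, Matrix.of_apply]
  by_cases hb : b = 0
  · subst hb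
    rw [h.col0]
    by_cases ha : a = i
    · subst ha; simp [mE, mF, hi]
    · simp [ha]
  · simp [hb, mF]; ring

theorem FE : Matrix.diagonal (mF x) * Matrix.diagonal (mE x) = x ^ 2 • (1 : Matrix (Fin 4) (Fin 4) R) := by
  rw [Matrix.diagonal_mul_diagonal, ← Matrix.diagonal_one, ← Matrix.diagonal_smul]
  congr 1; ext a
  by_cases ha : a = 0 <;> simp [mF, mE, ha, sq]

theorem MD.YA (h : MD x g q) (i : Fin 4) (hi : i ≠ 0) (A : Matrix (Fin 4) (Fin 4) R) :
    mY x g q i * (Matrix.diagonal (mE x) * A) = x • (Matrix.diagonal (mE x) * (q * g i) * A) := by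
  apply h.cancel
  rw [← Matrix.smul_mul, h.xY i hi, Matrix.mul_assoc _ (Matrix.diagonal (mF x)),
    ← Matrix.mul_assoc (Matrix.diagonal (mF x)), FE, Matrix.smul_mul, Matrix.one_mul,
    Matrix.mul_smul, smul_smul, sq]

theorem MD.YY (h : MD x g q) (i j : Fin 4) (hi : i ≠ 0) (hj : j ≠ 0) :
    mY x g q i * mY x g q j =
      Matrix.diagonal (mE x) * ((q * g i) * (q * g j)) * Matrix.diagonal (mF x) := by
  apply h.cancel
  rw [← Matrix.mul_smul, h.xY j hj, Matrix.mul_assoc _ (q * g j), h.YA i hi]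
  simp only [Matrix.mul_assoc]

theorem MD.H0 (h : MD x g q) (i j a : Fin 4) : mH g q i j a 0 = 0 := by
  have : ∀ i j, (g i * q * g j) a 0 = g i a j := by
    intro i j
    rw [Matrix.mul_assoc, Matrix.mul_apply]
    simp [h.col0]
  rw [mH, Matrix.sub_apply, this, this, h.sy0, sub_self]

theorem MD.Ht (h : MD x g q) (i j : Fin 4) : (mH g q i j).transpose = - mH g q i j := by
  simp [mH, Matrix.transpose_mul, h.sym, h.qsym, Matrix.mul_assoc]

theorem MD.H0' (h : MD x g q) (i j a : Fin 4) : mH g q i j 0 a = 0 := by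
  have := congrFun (congrFun (h.Ht i j) a) 0
  rwa [Matrix.transpose_apply, Matrix.neg_apply, h.H0, neg_zero] at this

theorem MD.comm (h : MD x g q) (i j : Fin 4) (hi : i ≠ 0) (hj : j ≠ 0) :
    mY x g q i * mY x g q j - mY x g q j * mY x g q i = mG x q * mH g q i j := by
  have e1 : mH g q i j * Matrix.diagonal (mF x) = x • mH g q i j := by
    ext a b
    rw [Matrix.mul_diagonal, Matrix.smul_apply, smul_eq_mul]
    by_cases hb : b = 0
    · subst hb; simp [h.H0]
    · simp [hb, mF, mul_comm]
  have e2 : Matrix.diagonal (mE x) * mH g q i j = x • mH g q i j := by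
    ext a b
    rw [Matrix.diagonal_mul, Matrix.smul_apply, smul_eq_mul]
    by_cases hb : a = 0
    · subst hb; simp [h.H0']
    · simp [hb, mE]
  rw [h.YY i j hi hj, h.YY j i hj hi, mG, Matrix.mul_assoc _ _ (mH g q i j), e2, ← e1, mH]
  simp only [Matrix.mul_assoc, Matrix.sub_mul, Matrix.mul_sub]

theorem MD.Gsym (h : MD x g q) : (mG x q).transpose = mG x q := by
  simp [mG, Matrix.transpose_mul, h.qsym, Matrix.mul_assoc]

theorem MD.GY (h : MD x g q) (i : Fin 4) (hi : i ≠ 0) :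
    mG x q * (mY x g q i).transpose = mY x g q i * mG x q := by
  have e : mY x g q i * mG x q =
      x • (Matrix.diagonal (mE x) * (q * g i) * (q * Matrix.diagonal (mE x))) := by
    rw [mG, Matrix.mul_assoc, h.YA i hi]
  calc mG x q * (mY x g q i).transpose = (mY x g q i * mG x q).transpose := by
        rw [Matrix.transpose_mul, h.Gsym]
    _ = mY x g q i * mG x q := by
      rw [e]
      simp [Matrix.transpose_mul, h.qsym, h.sym, Matrix.mul_assoc]

theorem MD.Ginj (h : MD x g q) : Function.Injective (mG x q).mulVecLin := by
  have hE : ∀ a b : Fin 4 → R, Matrix.mulVec (Matrix.diagonal (mE x)) a =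
      Matrix.mulVec (Matrix.diagonal (mE x)) b → a = b := by
    intro a b hab
    ext i
    have := congrFun hab i
    rw [Matrix.mulVec_diagonal, Matrix.mulVec_diagonal] at this
    by_cases hi : i = 0
    · simp only [mE, hi, if_true, sq, mul_assoc] at this ⊢
      exact h.x0 _ _ (h.x0 _ _ this)
    · simp only [mE, hi, if_false] at this
      exact h.x0 _ _ this
  intro a b hab
  simp only [Matrix.mulVecLin_apply, mG, ← Matrix.mulVec_mulVec] at hab
  have := congrArg (Matrix.mulVec (g 0)) (hE _ _ hab)
  simp only [Matrix.mulVec_mulVec, ← Matrix.mul_assoc, h.gq, Matrix.one_mul] at this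
  exact hE _ _ this

def opE (x : R) (g : Fin 4 → Matrix (Fin 4) (Fin 4) R) (q : Matrix (Fin 4) (Fin 4) R)
    (y : Fin 4 → R) (i : Fin 4) : (Fin 4 → R) →ₗ[R] (Fin 4 → R) :=
  y i • LinearMap.id - (mY x g q i).mulVecLin
def opZ (x : R) (g : Fin 4 → Matrix (Fin 4) (Fin 4) R) (q : Matrix (Fin 4) (Fin 4) R)
    (y : Fin 4 → R) (i : Fin 4) : (Fin 4 → R) →ₗ[R] (Fin 4 → R) :=
  y i • LinearMap.id - (mY x g q i).transpose.mulVecLin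

theorem MD.c (h : MD x g q) (y : Fin 4 → R) (i : Fin 4) (hi : i ≠ 0) (v) :
    (mG x q).mulVecLin (opZ x g q y i v) = opE x g q y i ((mG x q).mulVecLin v) := by
  simp only [opE, opZ, LinearMap.sub_apply, LinearMap.smul_apply, LinearMap.id_apply,
    Matrix.mulVecLin_apply, Matrix.mulVec_sub, Matrix.mulVec_smul, Matrix.mulVec_mulVec, h.GY i hi]

theorem MD.kk (h : MD x g q) (y : Fin 4 → R) (i j : Fin 4) (hi : i ≠ 0) (hj : j ≠ 0) (v) :
    opE x g q y i (opE x g q y j v) = opE x g q y j (opE x g q y i v) +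
      (mG x q).mulVecLin ((mH g q i j).mulVecLin v) := by
  simp only [opE, LinearMap.sub_apply, LinearMap.smul_apply, LinearMap.id_apply,
    Matrix.mulVecLin_apply, Matrix.mulVec_sub, Matrix.mulVec_smul, Matrix.mulVec_mulVec, 
    ← h.comm i j hi hj, Matrix.sub_mulVec]
  module

theorem MD.slots (h : MD x g q) (y : Fin 4 → R) :
    Slots (opE x g q y 1) (opE x g q y 2) (opE x g q y 3) (opZ x g q y 1) (opZ x g q y 2)
      (opZ x g q y 3) (mH g q 1 2).mulVecLin (mH g q 1 3).mulVecLin (mH g q 2 3).mulVecLin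
      (y 1) (y 2) (y 3) := by
  have s : ∀ i : Fin 4, ∀ t, ∀ a : Fin 4, a ≠ 0 →
      opE x g q y i (Pi.single 0 t) a = if a = i then -t else 0 := by
    intro i t a ha
    simp [opE, mY, ha, Matrix.mulVec_single]
    split_ifs <;> simp
  have t : ∀ i : Fin 4, ∀ v, opZ x g q y i v 0 = y i * v 0 - v i := by
    intro i v
    simp [opZ, mY, Matrix.vecMul, dotProduct]
  have u : ∀ i j : Fin 4, ∀ v, (mH g q i j).mulVecLin v 0 = 0 := by
    intro i j v
    simp [Matrix.mulVec, dotProduct, h.H0']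
  exact ⟨s 1, s 2, s 3, t 1, t 2, t 3, u _ _, u _ _, u _ _⟩

end Mats
section Poly
open MvPolynomial
variable {K : Type*} [Field K]

noncomputable def sg (i : Fin 4) : MvPolynomial (Fin 4) K →+ MvPolynomial (Fin 4) K where
  toFun f := f.divMonomial (Finsupp.single i 1)
  map_zero' := zero_divMonomial _
  map_add' _ _ := add_divMonomial _ _ _

theorem sg_iter (i : Fin 4) (n : ℕ) (f : MvPolynomial (Fin 4) K) :
    (sg i)^[n] f = f.divMonomial (Finsupp.single i n) := by
  induction n generalizing f with
  | zero => simp [divMonomial_zero]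
  | succ n ih =>
    rw [Function.iterate_succ_apply, ih, sg, AddMonoidHom.coe_mk, ZeroHom.coe_mk,
      ← divMonomial_add, ← Finsupp.single_add, add_comm]

theorem sg_nil (i : Fin 4) (f : MvPolynomial (Fin 4) K) (n : ℕ) (hn : f.totalDegree < n) :
    (sg i)^[n] f = 0 := by
  rw [sg_iter]
  ext m
  rw [coeff_divMonomial, coeff_zero]
  apply coeff_eq_zero_of_totalDegree_lt
  refine lt_of_lt_of_le hn ?_
  have : (Finsupp.single i n + m) i ≤ ∑ j ∈ (Finsupp.single i n + m).support, (Finsupp.single i n + m) j := by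
    apply Finset.single_le_sum (f := fun j => (Finsupp.single i n + m) j) (fun _ _ => Nat.zero_le _)
    simp; omega
  simp at this ⊢
  omega

/-- polynomials commuting with `sg i` -/
def Cm (i : Fin 4) : Subring (MvPolynomial (Fin 4) K) where
  carrier := {f | ∀ g, sg i (f * g) = f * sg i g}
  mul_mem' := by intro a b ha hb g; rw [mul_assoc, ha, hb, mul_assoc]
  one_mem' := by intro g; simp
  add_mem' := by intro a b ha hb g; rw [add_mul, map_add, ha, hb, add_mul]
  zero_mem' := by intro g; simp
  neg_mem' := by intro a ha g; rw [neg_mul, map_neg, ha, neg_mul]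

theorem C_mem_Cm (i : Fin 4) (a : K) : C a ∈ Cm (K := K) i := by
  intro g
  ext m
  simp [sg, coeff_divMonomial, coeff_C_mul]

theorem X_mem_Cm (i j : Fin 4) (h : j ≠ i) : X j ∈ Cm (K := K) i := by
  intro g
  ext m
  simp only [sg, AddMonoidHom.coe_mk, ZeroHom.coe_mk, coeff_divMonomial, coeff_X_mul']
  have : (j ∈ (Finsupp.single i 1 + m).support) ↔ j ∈ m.support := by
    simp [Finsupp.single_apply, h.symm]
  simp only [this]
  split_ifs with hj
  · congr 1
    ext a
    simp only [Finsupp.coe_tsub, Finsupp.coe_add, Pi.sub_apply, Pi.add_apply, Finsupp.single_apply]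
    split_ifs with h1 h2
    · exact absurd (h2.trans h1.symm) h
    all_goals omega
  · rfl

noncomputable def sgv (i : Fin 4) : (Fin 4 → MvPolynomial (Fin 4) K) →+ (Fin 4 → MvPolynomial (Fin 4) K) where
  toFun v := fun a => sg i (v a)
  map_zero' := by ext1 a; simp
  map_add' _ _ := by ext1 a; simp

theorem sgv_iter (i : Fin 4) (n : ℕ) (v : Fin 4 → MvPolynomial (Fin 4) K) (a) :
    (sgv i)^[n] v a = (sg i)^[n] (v a) := by
  induction n generalizing v with
  | zero => rfl
  | succ n ih => rw [Function.iterate_succ_apply, ih]; rfl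

theorem sgv_nil (i : Fin 4) (v : Fin 4 → MvPolynomial (Fin 4) K) : ∃ n : ℕ, (sgv i)^[n] v = 0 := by
  refine ⟨(∑ a, (v a).totalDegree) + 1, ?_⟩
  ext1 a
  rw [sgv_iter]
  apply sg_nil
  have := Finset.single_le_sum (f := fun a => (v a).totalDegree) (fun _ _ => Nat.zero_le _)
    (Finset.mem_univ a)
  omega

theorem sgv_mulVec (i : Fin 4) (A : Matrix (Fin 4) (Fin 4) (MvPolynomial (Fin 4) K))
    (hA : ∀ a b, A a b ∈ Cm i) (v) : sgv i (A.mulVec v) = A.mulVec (sgv i v) := by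
  ext1 a
  simp only [sgv, AddMonoidHom.coe_mk, ZeroHom.coe_mk, Matrix.mulVec, dotProduct, map_sum]
  exact Finset.sum_congr rfl fun b _ => hA a b _

theorem sgv_smul (i : Fin 4) (f : MvPolynomial (Fin 4) K)
    (hA : f ∈ Cm i) (v : Fin 4 → MvPolynomial (Fin 4) K) : sgv i (f • v) = f • (sgv i v) := by
  ext1 a
  exact hA _

theorem sgv_X (i : Fin 4) (v : Fin 4 → MvPolynomial (Fin 4) K) : sgv i ((X i : MvPolynomial (Fin 4) K) • v) = v := by
  ext1 a
  simp [sgv, sg]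

variable {g : Fin 4 → Matrix (Fin 4) (Fin 4) K} {q : Matrix (Fin 4) (Fin 4) K}

theorem mY_Cm (i j : Fin 4) (hi : i ≠ 0) (a b) :
    mY (X 0 : MvPolynomial (Fin 4) K) (fun i => (g i).map C) (q.map C) j a b ∈ Cm i := by
  have hx := X_mem_Cm (K := K) i 0 hi.symm
  simp only [mY, Matrix.of_apply, mE, Matrix.mul_apply, Matrix.map_apply]
  split_ifs
  · exact one_mem _
  · exact zero_mem _
  · exact mul_mem (sum_mem fun _ _ => mul_mem (C_mem_Cm _ _) (C_mem_Cm _ _)) (pow_mem hx _)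
  · exact mul_mem (sum_mem fun _ _ => mul_mem (C_mem_Cm _ _) (C_mem_Cm _ _)) hx

theorem mG_Cm (i : Fin 4) (hi : i ≠ 0) (a b) :
    mG (X 0 : MvPolynomial (Fin 4) K) (q.map C) a b ∈ Cm i := by
  have hx := X_mem_Cm (K := K) i 0 hi.symm
  have hE : ∀ a, mE (X 0 : MvPolynomial (Fin 4) K) a ∈ Cm i := by
    intro a; simp only [mE]; split_ifs
    · exact pow_mem hx _
    · exact hx
  rw [mG, Matrix.mul_diagonal, Matrix.diagonal_mul]
  exact mul_mem (mul_mem (hE _) (C_mem_Cm _ _)) (hE _)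

theorem rels_of (h : MD (X 0 : MvPolynomial (Fin 4) K) (fun i => (g i).map C) (q.map C)) :
    Rels (mG (X 0 : MvPolynomial (Fin 4) K) (q.map C)).mulVecLin
      (opE (X 0) (fun i => (g i).map C) (q.map C) X 1)
      (opE (X 0) (fun i => (g i).map C) (q.map C) X 2)
      (opE (X 0) (fun i => (g i).map C) (q.map C) X 3)
      (opZ (X 0) (fun i => (g i).map C) (q.map C) X 1)
      (opZ (X 0) (fun i => (g i).map C) (q.map C) X 2)
      (opZ (X 0) (fun i => (g i).map C) (q.map C) X 3)
      (mH (fun i => (g i).map C) (q.map C) 1 2).mulVecLin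
      (mH (fun i => (g i).map C) (q.map C) 1 3).mulVecLin
      (mH (fun i => (g i).map C) (q.map C) 2 3).mulVecLin := by
  have k12 := h.kk X 1 2 (by decide) (by decide)
  have k13 := h.kk X 1 3 (by decide) (by decide)
  have k23 := h.kk X 2 3 (by decide) (by decide)
  have c1 := h.c X 1 (by decide)
  have c2 := h.c X 2 (by decide)
  have c3 := h.c X 3 (by decide)
  have hG : ∀ i : Fin 4, i ≠ 0 → ∀ v, sgv i ((mG (X 0 : MvPolynomial (Fin 4) K) (q.map C)).mulVecLin v) =
      (mG (X 0 : MvPolynomial (Fin 4) K) (q.map C)).mulVecLin (sgv i v) :=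
    fun i hi v => sgv_mulVec i _ (mG_Cm i hi) v
  have hE : ∀ i j : Fin 4, i ≠ 0 → j ≠ i → ∀ v, sgv i (opE (X 0) (fun i => (g i).map C) (q.map C) X j v) =
      opE (X 0 : MvPolynomial (Fin 4) K) (fun i => (g i).map C) (q.map C) X j (sgv i v) := by
    intro i j hi hj v
    simp only [opE, LinearMap.sub_apply, LinearMap.smul_apply, LinearMap.id_apply,
      Matrix.mulVecLin_apply, map_sub, sgv_smul i _ (X_mem_Cm i j hj), sgv_mulVec i _ (mY_Cm i j hi)]
  have hc : ∀ i : Fin 4, i ≠ 0 → ∀ v, sgv i ((X i : MvPolynomial (Fin 4) K) • v - opE (X 0) (fun i => (g i).map C) (q.map C) X i v) =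
      (X i : MvPolynomial (Fin 4) K) • sgv i v - opE (X 0 : MvPolynomial (Fin 4) K) (fun i => (g i).map C) (q.map C) X i (sgv i v) := by
    intro i hi v
    simp only [opE, LinearMap.sub_apply, LinearMap.smul_apply, LinearMap.id_apply,
      Matrix.mulVecLin_apply, sub_sub_cancel, sgv_mulVec i _ (mY_Cm i i hi)]
  refine ⟨h.Ginj, c1, c2, c3, k12, k13, k23, ?_, ?_, ?_⟩
  · generalize (mG (X 0 : MvPolynomial (Fin 4) K) (q.map C)).mulVecLin = G at *
    intro v a hv
    have := red_core (LinearMap.range G) (X 1) _ (sgv 1)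
      (by rintro _ ⟨a, rfl⟩; exact ⟨_, (hG 1 (by decide) a).symm⟩)
      (by rintro _ ⟨a, rfl⟩; exact ⟨_, c1 a⟩) (sgv_X 1) (hc 1 (by decide)) (sgv_nil 1) v
      ⟨a, hv.symm⟩
    obtain ⟨b, hb⟩ := this
    exact ⟨b, hb.symm⟩
  · generalize (mG (X 0 : MvPolynomial (Fin 4) K) (q.map C)).mulVecLin = G at *
    intro v a b hv
    have := red_core (LinearMap.range (G.coprod (opE (X 0) (fun i => (g i).map C) (q.map C) X 1)))
      (X 2) _ (sgv 2)
      (by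
        rintro _ ⟨⟨a, b⟩, rfl⟩
        refine ⟨(sgv 2 a, sgv 2 b), ?_⟩
        simp only [LinearMap.coprod_apply, map_add, hG 2 (by decide), hE 2 1 (by decide) (by decide)])
      (by
        rintro _ ⟨⟨a, b⟩, rfl⟩
        refine ⟨(opZ (X 0) (fun i => (g i).map C) (q.map C) X 2 a - (mH (fun i => (g i).map C) (q.map C) 1 2).mulVecLin b, opE (X 0) (fun i => (g i).map C) (q.map C) X 2 b), ?_⟩
        simp only [LinearMap.coprod_apply, map_add, map_sub, c2, k12]
        abel)
      (sgv_X 2) (hc 2 (by decide)) (sgv_nil 2) v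
      ⟨(a, b), hv.symm⟩
    obtain ⟨⟨a, b⟩, hb⟩ := this
    exact ⟨a, b, hb.symm⟩
  · generalize (mG (X 0 : MvPolynomial (Fin 4) K) (q.map C)).mulVecLin = G at *
    intro v a b c hv
    have := red_core (LinearMap.range ((G.coprod (opE (X 0) (fun i => (g i).map C) (q.map C) X 1)).coprod
        (opE (X 0) (fun i => (g i).map C) (q.map C) X 2)))
      (X 3) _ (sgv 3)
      (by
        rintro _ ⟨⟨⟨a, b⟩, c⟩, rfl⟩
        refine ⟨((sgv 3 a, sgv 3 b), sgv 3 c), ?_⟩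
        simp only [LinearMap.coprod_apply, map_add, hG 3 (by decide), hE 3 1 (by decide) (by decide),
          hE 3 2 (by decide) (by decide)])
      (by
        rintro _ ⟨⟨⟨a, b⟩, c⟩, rfl⟩
        refine ⟨((opZ (X 0) (fun i => (g i).map C) (q.map C) X 3 a - (mH (fun i => (g i).map C) (q.map C) 1 3).mulVecLin b - (mH (fun i => (g i).map C) (q.map C) 2 3).mulVecLin c, opE (X 0) (fun i => (g i).map C) (q.map C) X 3 b), opE (X 0) (fun i => (g i).map C) (q.map C) X 3 c), ?_⟩
        simp only [LinearMap.coprod_apply, map_add, map_sub, c3, k13, k23]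
        abel)
      (sgv_X 3) (hc 3 (by decide)) (sgv_nil 3) v
      ⟨((a, b), c), hv.symm⟩
    obtain ⟨⟨⟨a, b⟩, c⟩, hb⟩ := this
    exact ⟨a, b, c, hb.symm⟩

end Poly
section Ident
variable {K : Type*} [Field K]

theorem Phi_hom {Φ : MvPolynomial (Fin 4) K →ₗ[K] K}
    (hΦ : ∀ m : Fin 4 →₀ ℕ, (m.sum fun _ e => e) ≠ 3 → Φ (monomial m 1) = 0)
    {f : MvPolynomial (Fin 4) K} {n : ℕ} (hf : f.IsHomogeneous n) (hn : n ≠ 3) : Φ f = 0 := by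
  rw [f.as_sum, map_sum]
  apply Finset.sum_eq_zero
  intro m hm
  have h1 : m.degree = n := by
    by_contra h
    exact (mem_support_iff.mp hm) (hf.coeff_eq_zero h)
  have h2 : monomial m (coeff m f) = coeff m f • monomial m (1 : K) := by
    rw [smul_monomial, smul_eq_mul, mul_one]
  rw [h2, map_smul, hΦ m, smul_zero]
  intro h3
  apply hn
  rw [← h1, ← h3]
  rfl

theorem ann_of {Φ : MvPolynomial (Fin 4) K →ₗ[K] K}
    (hΦ : ∀ m : Fin 4 →₀ ℕ, (m.sum fun _ e => e) ≠ 3 → Φ (monomial m 1) = 0)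
    {f : MvPolynomial (Fin 4) K} {d : ℕ} (hf : f.IsHomogeneous d)
    (h : ∀ m e, d + e = 3 → IsHomogeneous m e → Φ (f * m) = 0) : f ∈ annIdeal K Φ := by
  intro m
  rw [← sum_homogeneousComponent m, Finset.mul_sum, map_sum]
  apply Finset.sum_eq_zero
  intro i _
  have hi := homogeneousComponent_isHomogeneous i m
  by_cases hd : d + i = 3
  · exact h _ i hd hi
  · exact Phi_hom hΦ (hf.mul hi) hd

theorem lin_ind {Q : MvPolynomial (Fin 4) K → Prop} (h0 : Q 0) (hX : ∀ i, Q (X i))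
    (hadd : ∀ a b, Q a → Q b → Q (a + b)) (hs : ∀ (c : K) a, Q a → Q (C c * a))
    {l : MvPolynomial (Fin 4) K} (hl : l.IsHomogeneous 1) : Q l := by
  have : l ∈ Submodule.span K (Set.range (X : Fin 4 → MvPolynomial (Fin 4) K)) := by
    rw [← homogeneousSubmodule_one_eq_span_X]; exact hl
  clear hl
  induction this using Submodule.span_induction with
  | mem x hx => obtain ⟨i, rfl⟩ := hx; exact hX i
  | zero => exact h0
  | add a b _ _ ha hb => exact hadd _ _ ha hb
  | smul c a _ ha => rw [smul_eq_C_mul]; exact hs _ _ ha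

/-- the structure constants -/
def gam (Φ : MvPolynomial (Fin 4) K →ₗ[K] K) (i : Fin 4) : Matrix (Fin 4) (Fin 4) K :=
  Matrix.of fun a b => Φ (X i * X a * X b)

theorem p_inj {Φ : MvPolynomial (Fin 4) K →ₗ[K] K} (hp : Function.Bijective (pMap K Φ))
    {l : MvPolynomial (Fin 4) K} (hl : l.IsHomogeneous 1)
    (h : ∀ a, Φ (X 0 * l * X a) = 0) : l = 0 := by
  have h1 : pMap K Φ ⟨l, hl⟩ = 0 := by
    ext ⟨v, hv⟩
    change Φ (X 0 * l * v) = 0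
    refine lin_ind (Q := fun v => Φ (X 0 * l * v) = 0) (by simp) h ?_ ?_ hv
    · intro a b ha hb; rw [mul_add, map_add, ha, hb, add_zero]
    · intro c a ha; rw [← smul_eq_C_mul, mul_smul_comm, map_smul, ha, smul_zero]
  have h2 := hp.injective (h1.trans (map_zero _).symm)
  exact congrArg Subtype.val h2

theorem gam_det {Φ : MvPolynomial (Fin 4) K →ₗ[K] K} (hp : Function.Bijective (pMap K Φ)) :
    IsUnit (gam Φ 0).det := by
  rw [isUnit_iff_ne_zero]
  intro hdet
  obtain ⟨v, hv, hv0⟩ := Matrix.exists_mulVec_eq_zero_iff.mpr hdet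
  apply hv
  have hl : (∑ a, C (v a) * X a : MvPolynomial (Fin 4) K).IsHomogeneous 1 :=
    IsHomogeneous.sum _ _ _ fun a _ => isHomogeneous_C_mul_X _ _
  have := p_inj hp hl (by
    intro a
    have := congrFun hv0 a
    simp only [Matrix.mulVec, dotProduct, gam, Matrix.of_apply, Pi.zero_apply] at this
    rw [← this, Finset.mul_sum, Finset.sum_mul, map_sum]
    refine Finset.sum_congr rfl fun b _ => ?_
    rw [← smul_eq_C_mul, mul_smul_comm, smul_mul_assoc, map_smul, smul_eq_mul, mul_comm,
      mul_right_comm])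
  ext b
  have h3 := congrArg (coeff (Finsupp.single b 1)) this
  simpa [coeff_sum, coeff_C_mul, coeff_X, Finsupp.single_left_inj] using h3

theorem md_of {Φ : MvPolynomial (Fin 4) K →ₗ[K] K} (hp : Function.Bijective (pMap K Φ)) :
    MD (X 0 : MvPolynomial (Fin 4) K) (fun i => (gam Φ i).map C) ((gam Φ 0)⁻¹.map C) where
  x0 a b h := mul_left_cancel₀ (X_ne_zero 0) h
  sym i := by
    ext1 a b
    simp only [Matrix.transpose_apply, Matrix.map_apply, gam, Matrix.of_apply, mul_right_comm]
  sy0 i j a := by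
    simp only [Matrix.map_apply, gam, Matrix.of_apply]
    congr 2; ring
  qg := by rw [← Matrix.map_mul, Matrix.nonsing_inv_mul _ (gam_det hp)]; exact Matrix.map_one _ C_0 C_1
  gq := by rw [← Matrix.map_mul, Matrix.mul_nonsing_inv _ (gam_det hp)]; exact Matrix.map_one _ C_0 C_1

def tt (a : Fin 4) : MvPolynomial (Fin 4) K := if a = 0 then 1 else X a

theorem tt_mE (a : Fin 4) : tt a * mE (X 0 : MvPolynomial (Fin 4) K) a = X 0 * X a := by
  by_cases h : a = 0
  · subst h; simp [tt, mE, sq]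
  · simp [tt, mE, h, mul_comm]

def eps : (Fin 4 → MvPolynomial (Fin 4) K) →ₗ[MvPolynomial (Fin 4) K] MvPolynomial (Fin 4) K where
  toFun w := ∑ a, tt a * w a
  map_add' v w := by simp [mul_add, Finset.sum_add_distrib]
  map_smul' r w := by simp [Finset.mul_sum, mul_left_comm]

def ww (g : Fin 4 → Matrix (Fin 4) (Fin 4) K) (q : Matrix (Fin 4) (Fin 4) K) (i b : Fin 4) :
    MvPolynomial (Fin 4) K := X i * X b - X 0 * ∑ a, C ((q * g i) a b) * X a
def vv (q : Matrix (Fin 4) (Fin 4) K) (b : Fin 4) :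
    MvPolynomial (Fin 4) K := ∑ a, C (q a b) * X a

variable {g : Fin 4 → Matrix (Fin 4) (Fin 4) K} {q : Matrix (Fin 4) (Fin 4) K}

theorem eps_mulVec (A : Matrix (Fin 4) (Fin 4) (MvPolynomial (Fin 4) K)) (v) :
    eps (A.mulVec v) = ∑ b, v b * ∑ a, tt a * A a b := by
  simp only [eps, LinearMap.coe_mk, AddHom.coe_mk, Matrix.mulVec, dotProduct, Finset.mul_sum]
  rw [Finset.sum_comm]
  exact Finset.sum_congr rfl fun b _ => Finset.sum_congr rfl fun a _ => by ring

theorem eps_E (i : Fin 4) (hi : i ≠ 0) (v : Fin 4 → MvPolynomial (Fin 4) K) :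
    eps (opE (X 0) (fun i => (g i).map C) (q.map C) X i v) =
      ∑ b, v b * (if b = 0 then 0 else ww g q i b) := by
  have h : opE (X 0) (fun i => (g i).map C) (q.map C) X i v = (X i : MvPolynomial (Fin 4) K) • v -
    (mY (X 0) (fun i => (g i).map C) (q.map C) i).mulVec v := rfl
  rw [h, map_sub, eps_mulVec, map_smul, eps]
  simp only [LinearMap.coe_mk, AddHom.coe_mk]
  rw [smul_eq_mul, Finset.mul_sum, ← Finset.sum_sub_distrib]
  refine Finset.sum_congr rfl fun b _ => ?_
  have h2 : ∑ a, tt a * mY (X 0 : MvPolynomial (Fin 4) K) (fun i => (g i).map C) (q.map C) i a b =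
      if b = 0 then X i else X 0 * ∑ a, C ((q * g i) a b) * X a := by
    by_cases hb : b = 0
    · simp [hb, mY, tt, hi]
    · simp only [mY, Matrix.of_apply, hb, if_false, ← Matrix.map_mul, Matrix.map_apply, Finset.mul_sum]
      refine Finset.sum_congr rfl fun a _ => ?_
      rw [mul_left_comm, tt_mE]; ring
  rw [h2]
  by_cases hb : b = 0
  · simp [hb, tt]; ring
  · simp [hb, tt, ww]; ring

theorem eps_G (v : Fin 4 → MvPolynomial (Fin 4) K) :
    eps ((mG (X 0 : MvPolynomial (Fin 4) K) (q.map C)).mulVecLin v) =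
      ∑ b, v b * (X 0 * mE (X 0) b * vv q b) := by
  rw [Matrix.mulVecLin_apply, eps_mulVec]
  refine Finset.sum_congr rfl fun b _ => ?_
  congr 1
  rw [vv, Finset.mul_sum]
  refine Finset.sum_congr rfl fun a _ => ?_
  rw [mG, Matrix.mul_diagonal, Matrix.diagonal_mul, Matrix.map_apply, ← mul_assoc, ← mul_assoc, tt_mE]
  ring

theorem eps_single (p : MvPolynomial (Fin 4) K) : eps (Pi.single 0 p) = p := by
  simp [eps, tt, Fin.sum_univ_four]

theorem vv_hom (b : Fin 4) : (vv q b).IsHomogeneous 1 :=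
  IsHomogeneous.sum _ _ _ fun _ _ => isHomogeneous_C_mul_X _ _

theorem ww_hom (i b : Fin 4) : (ww g q i b).IsHomogeneous 2 :=
  ((isHomogeneous_X K i).mul (isHomogeneous_X K b)).sub
    ((isHomogeneous_X K 0).mul (IsHomogeneous.sum _ _ _ fun _ _ => isHomogeneous_C_mul_X _ _))

theorem ww_ann {Φ : MvPolynomial (Fin 4) K →ₗ[K] K}
    (hΦ : ∀ m : Fin 4 →₀ ℕ, (m.sum fun _ e => e) ≠ 3 → Φ (monomial m 1) = 0)
    (hp : Function.Bijective (pMap K Φ)) (i b : Fin 4) :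
    ww (gam Φ) (gam Φ 0)⁻¹ i b ∈ annIdeal K Φ := by
  apply ann_of hΦ (ww_hom i b)
  intro m e he hm
  obtain rfl : e = 1 := by omega
  refine lin_ind (Q := fun v => Φ (ww (gam Φ) (gam Φ 0)⁻¹ i b * v) = 0) (by simp) ?_ ?_ ?_ hm
  · intro c
    have h1 : (gam Φ 0 * ((gam Φ 0)⁻¹ * gam Φ i)) c b = gam Φ i c b := by
      rw [Matrix.mul_nonsing_inv_cancel_left _ _ (gam_det hp)]
    rw [Matrix.mul_apply] at h1
    rw [ww, sub_mul, map_sub, sub_eq_zero, Finset.mul_sum, Finset.sum_mul, map_sum]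
    have h2 : Φ (X i * X b * X c) = gam Φ i c b := by
      rw [gam, Matrix.of_apply, mul_right_comm]
    rw [h2, ← h1]
    refine Finset.sum_congr rfl fun a _ => ?_
    rw [← smul_eq_C_mul, mul_smul_comm, smul_mul_assoc, map_smul, smul_eq_mul, mul_comm, gam,
      Matrix.of_apply, mul_right_comm]
  · intro a b ha hb; rw [mul_add, map_add, ha, hb, add_zero]
  · intro c a ha; rw [← smul_eq_C_mul, mul_smul_comm, map_smul, ha, smul_zero]

theorem Phi_vv {Φ : MvPolynomial (Fin 4) K →ₗ[K] K}
    (hp : Function.Bijective (pMap K Φ)) (b : Fin 4) :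
    Φ (X 0 * X 0 * vv (gam Φ 0)⁻¹ b) = if b = 0 then 1 else 0 := by
  have h1 : (gam Φ 0 * (gam Φ 0)⁻¹) 0 b = (1 : Matrix (Fin 4) (Fin 4) K) 0 b := by
    rw [Matrix.mul_nonsing_inv _ (gam_det hp)]
  rw [Matrix.one_apply, Matrix.mul_apply] at h1
  simp only [eq_comm (a := (0 : Fin 4)) (b := b)] at h1
  rw [← h1, vv, Finset.mul_sum, map_sum]
  refine Finset.sum_congr rfl fun a _ => ?_
  rw [← smul_eq_C_mul, mul_smul_comm, map_smul, smul_eq_mul, mul_comm, gam, Matrix.of_apply]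

theorem vv_ann {Φ : MvPolynomial (Fin 4) K →ₗ[K] K}
    (hΦ : ∀ m : Fin 4 →₀ ℕ, (m.sum fun _ e => e) ≠ 3 → Φ (monomial m 1) = 0)
    (hp : Function.Bijective (pMap K Φ)) (b : Fin 4) :
    X 0 * mE (X 0) b * vv (gam Φ 0)⁻¹ b ∈ annIdeal K Φ := by
  by_cases hb : b = 0
  · have hh : (X 0 * mE (X 0) b * vv (gam Φ 0)⁻¹ b).IsHomogeneous (1 + 1 * 2 + 1) := by
      simp only [mE, hb, if_true]
      exact ((isHomogeneous_X K 0).mul ((isHomogeneous_X K 0).pow 2)).mul (vv_hom _)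
    apply ann_of hΦ hh
    intro m e he; omega
  · have hh : (X 0 * mE (X 0) b * vv (gam Φ 0)⁻¹ b).IsHomogeneous (1 + 1 + 1) := by
      simp only [mE, hb, if_false]
      exact ((isHomogeneous_X K 0).mul (isHomogeneous_X K 0)).mul (vv_hom _)
    apply ann_of hΦ hh
    intro m e he hm
    obtain rfl : e = 0 := by omega
    obtain ⟨c, rfl⟩ : ∃ c, m = C c :=
      ⟨_, totalDegree_eq_zero_iff_eq_C.mp (Nat.le_zero.mp hm.totalDegree_le)⟩
    rw [mul_comm, ← smul_eq_C_mul, map_smul]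
    simp only [mE, hb, if_false]
    rw [Phi_vv hp, if_neg hb, smul_zero]

end Ident
section Ident2
variable {K : Type*} [Field K]

/-- the first differential -/
def DD (Φ : MvPolynomial (Fin 4) K →ₗ[K] K) :=
  dd1 (mG (X 0 : MvPolynomial (Fin 4) K) ((gam Φ 0)⁻¹.map C)).mulVecLin
      (opE (X 0) (fun i => (gam Φ i).map C) ((gam Φ 0)⁻¹.map C) X 1)
      (opE (X 0) (fun i => (gam Φ i).map C) ((gam Φ 0)⁻¹.map C) X 2)
      (opE (X 0) (fun i => (gam Φ i).map C) ((gam Φ 0)⁻¹.map C) X 3)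

def JJ (Φ : MvPolynomial (Fin 4) K →ₗ[K] K) : Ideal (MvPolynomial (Fin 4) K) :=
  Submodule.comap (LinearMap.single (MvPolynomial (Fin 4) K) (fun _ : Fin 4 => MvPolynomial (Fin 4) K) 0)
    (LinearMap.range (DD Φ))

variable {Φ : MvPolynomial (Fin 4) K →ₗ[K] K}

theorem mem_JJ (p : MvPolynomial (Fin 4) K) : p ∈ JJ Φ ↔ ∃ c, DD Φ c =
    Pi.single (M := fun _ => MvPolynomial (Fin 4) K) 0 p := Iff.rfl

theorem eps_DD_ann
    (hΦ : ∀ m : Fin 4 →₀ ℕ, (m.sum fun _ e => e) ≠ 3 → Φ (monomial m 1) = 0)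
    (hp : Function.Bijective (pMap K Φ)) (c) : eps (DD Φ c) ∈ annIdeal K Φ := by
  have hE : ∀ i : Fin 4, i ≠ 0 → ∀ v,
      eps (opE (X 0) (fun i => (gam Φ i).map C) ((gam Φ 0)⁻¹.map C) X i v) ∈ annIdeal K Φ := by
    intro i hi v
    rw [eps_E i hi]
    refine Ideal.sum_mem _ fun b _ => Ideal.mul_mem_left _ _ ?_
    split_ifs
    · exact zero_mem _
    · exact ww_ann hΦ hp i b
  have hG : ∀ v, eps ((mG (X 0 : MvPolynomial (Fin 4) K) ((gam Φ 0)⁻¹.map C)).mulVecLin v) ∈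
      annIdeal K Φ := by
    intro v
    rw [eps_G]
    exact Ideal.sum_mem _ fun b _ => Ideal.mul_mem_left _ _ (vv_ann hΦ hp b)
  simp only [DD, dd1, LinearMap.coe_mk, AddHom.coe_mk, map_add]
  exact Ideal.add_mem _ (Ideal.add_mem _ (Ideal.add_mem _ (hE 1 (by decide) _) (hE 2 (by decide) _))
    (hE 3 (by decide) _)) (hG _)

theorem JJ_le (hΦ : ∀ m : Fin 4 →₀ ℕ, (m.sum fun _ e => e) ≠ 3 → Φ (monomial m 1) = 0)
    (hp : Function.Bijective (pMap K Φ)) : JJ Φ ≤ annIdeal K Φ := by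
  intro p hp'
  rw [mem_JJ] at hp'
  obtain ⟨c, hc⟩ := hp'
  have := eps_DD_ann hΦ hp c
  rwa [hc, eps_single] at this

theorem opE_mem (i : Fin 4) (hi : i ≠ 0) (v) :
    opE (X 0) (fun i => (gam Φ i).map C) ((gam Φ 0)⁻¹.map C) X i v ∈ LinearMap.range (DD Φ) := by
  have : i = 1 ∨ i = 2 ∨ i = 3 := by
    revert hi; revert i; decide
  obtain rfl | rfl | rfl := this
  · exact ⟨(v, 0, 0, 0), by simp [DD, dd1]⟩
  · exact ⟨(0, v, 0, 0), by simp [DD, dd1]⟩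
  · exact ⟨(0, 0, v, 0), by simp [DD, dd1]⟩

theorem opG_mem (v) : (mG (X 0 : MvPolynomial (Fin 4) K) ((gam Φ 0)⁻¹.map C)).mulVecLin v ∈
    LinearMap.range (DD Φ) := ⟨(0, 0, 0, v), by simp [DD, dd1]⟩

theorem eps_mem (w : Fin 4 → MvPolynomial (Fin 4) K) (hw : w ∈ LinearMap.range (DD Φ)) :
    eps w ∈ JJ Φ := by
  change Pi.single 0 (eps w) ∈ LinearMap.range (DD Φ)
  have key : ∀ i : Fin 4, i ≠ 0 → ∀ t : MvPolynomial (Fin 4) K,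
      Pi.single 0 (X i * t) - Pi.single i t ∈ LinearMap.range (DD Φ) := by
    intro i hi t
    convert opE_mem (Φ := Φ) i hi (Pi.single 0 t) using 1
    ext1 a
    simp only [opE, LinearMap.sub_apply, LinearMap.smul_apply, LinearMap.id_apply, Matrix.mulVecLin_apply,
      Pi.sub_apply, Pi.smul_apply, mY, Matrix.mulVec_single, Matrix.col_apply, Matrix.of_apply, if_true]
    by_cases h0 : a = 0
    · subst h0
      simp [hi, hi.symm]
    · by_cases h1 : a = i
      · subst h1; simp [hi]
      · simp [h0, h1]
  have h2 : Pi.single 0 (eps w) = w + ((Pi.single 0 (X 1 * w 1) - Pi.single 1 (w 1)) +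
      (Pi.single 0 (X 2 * w 2) - Pi.single 2 (w 2)) + (Pi.single 0 (X 3 * w 3) - Pi.single 3 (w 3))) := by
    ext1 a
    fin_cases a <;> simp [eps, tt, Fin.sum_univ_four]
    ring
  rw [h2]
  exact add_mem hw (add_mem (add_mem (key 1 (by decide) _) (key 2 (by decide) _)) (key 3 (by decide) _))

theorem ww_JJ (hp : Function.Bijective (pMap K Φ)) (i b : Fin 4) :
    ww (gam Φ) (gam Φ 0)⁻¹ i b ∈ JJ Φ := by
  by_cases hi : i = 0
  · have : ww (gam Φ) (gam Φ 0)⁻¹ i b = 0 := by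
      rw [ww, hi, Matrix.nonsing_inv_mul _ (gam_det hp)]
      simp [Matrix.one_apply]
    rw [this]; exact zero_mem _
  by_cases hb : b = 0
  · have h1 : ∀ a, ((gam Φ 0)⁻¹ * gam Φ i) a 0 = if a = i then 1 else 0 := by
      intro a
      have h2 : ((gam Φ 0)⁻¹ * gam Φ 0) a i = (1 : Matrix (Fin 4) (Fin 4) K) a i := by
        rw [Matrix.nonsing_inv_mul _ (gam_det hp)]
      rw [Matrix.one_apply, Matrix.mul_apply] at h2
      rw [Matrix.mul_apply, ← h2]
      refine Finset.sum_congr rfl fun c _ => ?_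
      simp only [gam, Matrix.of_apply]
      congr 2; ring
    have : ww (gam Φ) (gam Φ 0)⁻¹ i b = 0 := by
      rw [ww, hb]
      simp [h1, mul_comm]
    rw [this]; exact zero_mem _
  have := eps_mem _ (opE_mem (Φ := Φ) i hi (Pi.single b 1))
  rw [eps_E i hi] at this
  rw [Finset.sum_eq_single b (fun c _ hc => by rw [Pi.single_eq_of_ne hc, zero_mul])
    (fun h => absurd (Finset.mem_univ b) h), Pi.single_eq_same, one_mul, if_neg hb] at this
  exact this

theorem vv_JJ (b : Fin 4) :
    X 0 * mE (X 0) b * vv (gam Φ 0)⁻¹ b ∈ JJ Φ := by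
  have := eps_mem _ (opG_mem (Φ := Φ) (Pi.single b 1))
  rw [eps_G] at this
  simpa [Pi.single_apply] using this

theorem mulX (hp : Function.Bijective (pMap K Φ)) (i : Fin 4) {l : MvPolynomial (Fin 4) K}
    (hl : l.IsHomogeneous 1) :
    ∃ l2 : MvPolynomial (Fin 4) K, l2.IsHomogeneous 1 ∧ l * X i - X 0 * l2 ∈ JJ Φ := by
  refine lin_ind (Q := fun l => ∃ l2 : MvPolynomial (Fin 4) K, l2.IsHomogeneous 1 ∧
    l * X i - X 0 * l2 ∈ JJ Φ) ?_ ?_ ?_ ?_ hl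
  · exact ⟨0, isHomogeneous_zero _ _ _, by simp⟩
  · intro j
    exact ⟨_, IsHomogeneous.sum _ _ _ fun a _ => isHomogeneous_C_mul_X _ _, ww_JJ hp j i⟩
  · rintro a b ⟨a', ha, ha'⟩ ⟨b', hb, hb'⟩
    refine ⟨a' + b', ha.add hb, ?_⟩
    convert add_mem ha' hb' using 1; ring
  · rintro c a ⟨a', ha, ha'⟩
    refine ⟨C c * a', ha.C_mul c, ?_⟩
    convert Ideal.mul_mem_left _ (C c) ha' using 1; ring

def th (Φ : MvPolynomial (Fin 4) K →ₗ[K] K) : MvPolynomial (Fin 4) K := X 0 * X 0 * vv (gam Φ 0)⁻¹ 0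

theorem x_th : X 0 * th Φ ∈ JJ Φ := by
  convert vv_JJ (Φ := Φ) 0 using 1
  simp [th, mE]; ring

theorem xx_lin (hp : Function.Bijective (pMap K Φ)) {l : MvPolynomial (Fin 4) K}
    (hl : l.IsHomogeneous 1) : ∃ c : K, X 0 * X 0 * l - C c * th Φ ∈ JJ Φ := by
  refine lin_ind (Q := fun l => ∃ c : K, X 0 * X 0 * l - C c * th Φ ∈ JJ Φ) ?_ ?_ ?_ ?_ hl
  · exact ⟨0, by simp⟩
  · intro j
    refine ⟨gam Φ 0 0 j, ?_⟩
    have h1 : (X j : MvPolynomial (Fin 4) K) = ∑ b, C (gam Φ 0 b j) * vv (gam Φ 0)⁻¹ b := by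
      simp only [vv, Finset.mul_sum]
      rw [Finset.sum_comm]
      have h3 : ∀ a, ∑ b, C (gam Φ 0 b j) * (C ((gam Φ 0)⁻¹ a b) * X a) =
          C (((gam Φ 0)⁻¹ * gam Φ 0) a j) * (X a : MvPolynomial (Fin 4) K) := by
        intro a
        rw [Matrix.mul_apply, map_sum, Finset.sum_mul]
        refine Finset.sum_congr rfl fun b _ => ?_
        rw [C_mul]; ring
      simp only [h3, Matrix.nonsing_inv_mul _ (gam_det hp), Matrix.one_apply]
      simp
    have hh : ∀ b : Fin 4, b ≠ 0 → X 0 * X 0 * vv (gam Φ 0)⁻¹ b ∈ JJ Φ := by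
      intro b hb
      have := vv_JJ (Φ := Φ) b
      simpa only [mE, hb, if_false] using this
    have h4 : X 0 * X 0 * X j - C (gam Φ 0 0 j) * th Φ =
        C (gam Φ 0 1 j) * (X 0 * X 0 * vv (gam Φ 0)⁻¹ 1) + C (gam Φ 0 2 j) * (X 0 * X 0 * vv (gam Φ 0)⁻¹ 2) +
          C (gam Φ 0 3 j) * (X 0 * X 0 * vv (gam Φ 0)⁻¹ 3) := by
      rw [h1, Fin.sum_univ_four, th]; ring
    rw [h4]
    exact add_mem (add_mem (Ideal.mul_mem_left _ _ (hh 1 (by decide)))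
      (Ideal.mul_mem_left _ _ (hh 2 (by decide)))) (Ideal.mul_mem_left _ _ (hh 3 (by decide)))
  · rintro a b ⟨a', ha'⟩ ⟨b', hb'⟩
    refine ⟨a' + b', ?_⟩
    convert add_mem ha' hb' using 1; rw [C_add]; ring
  · rintro c a ⟨a', ha'⟩
    refine ⟨c * a', ?_⟩
    convert Ideal.mul_mem_left _ (C c) ha' using 1; rw [C_mul]; ring

theorem th_X (hp : Function.Bijective (pMap K Φ)) (i : Fin 4) : th Φ * X i ∈ JJ Φ := by
  obtain ⟨l2, h2, h3⟩ := mulX hp i (vv_hom (q := (gam Φ 0)⁻¹) 0)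
  obtain ⟨c, hc⟩ := xx_lin hp h2
  have : th Φ * X i = X 0 * X 0 * (vv (gam Φ 0)⁻¹ 0 * X i - X 0 * l2) +
      X 0 * (X 0 * X 0 * l2 - C c * th Φ) + C c * (X 0 * th Φ) := by
    rw [th]; ring
  rw [this]
  exact add_mem (add_mem (Ideal.mul_mem_left _ _ h3) (Ideal.mul_mem_left _ _ hc))
    (Ideal.mul_mem_left _ _ x_th)

theorem normal_form (hp : Function.Bijective (pMap K Φ)) (f : MvPolynomial (Fin 4) K) :
    ∃ c0 c : K, ∃ l l' : MvPolynomial (Fin 4) K, l.IsHomogeneous 1 ∧ l'.IsHomogeneous 1 ∧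
      f - (C c0 + l + X 0 * l' + C c * th Φ) ∈ JJ Φ := by
  induction f using MvPolynomial.induction_on with
  | C a => exact ⟨a, 0, 0, 0, isHomogeneous_zero _ _ _, isHomogeneous_zero _ _ _, by simp⟩
  | add p q hp hq =>
    obtain ⟨a, b, l, l', h1, h2, h3⟩ := hp
    obtain ⟨a', b', m, m', h1', h2', h3'⟩ := hq
    refine ⟨a + a', b + b', l + m, l' + m', h1.add h1', h2.add h2', ?_⟩
    convert add_mem h3 h3' using 1; rw [C_add, C_add]; ring
  | mul_X p i hq =>
    obtain ⟨a, b, l, l', h1, h2, h3⟩ := hq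
    obtain ⟨m, hm, hm'⟩ := mulX hp i h1
    obtain ⟨n, hn, hn'⟩ := mulX hp i h2
    obtain ⟨c, hc⟩ := xx_lin hp hn
    refine ⟨0, c, C a * X i, m, isHomogeneous_C_mul_X _ _, hm, ?_⟩
    have : p * X i - (C 0 + C a * X i + X 0 * m + C c * th Φ) =
        X i * (p - (C a + l + X 0 * l' + C b * th Φ)) + (l * X i - X 0 * m) +
        X 0 * (l' * X i - X 0 * n) + (X 0 * X 0 * n - C c * th Φ) + C b * (th Φ * X i) := by
      rw [C_0]; ring
    rw [this]
    exact add_mem (add_mem (add_mem (add_mem (Ideal.mul_mem_left _ _ h3) hm')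
      (Ideal.mul_mem_left _ _ hn')) hc) (Ideal.mul_mem_left _ _ (th_X hp i))

theorem th_hom : (th Φ).IsHomogeneous 3 :=
  ((isHomogeneous_X K 0).mul (isHomogeneous_X K 0)).mul (vv_hom _)

theorem ann_le (hΦ : ∀ m : Fin 4 →₀ ℕ, (m.sum fun _ e => e) ≠ 3 → Φ (monomial m 1) = 0)
    (hp : Function.Bijective (pMap K Φ)) : annIdeal K Φ ≤ JJ Φ := by
  intro f hf
  obtain ⟨a, b, l, l', h1, h2, h3⟩ := normal_form hp f
  have hr : C a + l + X 0 * l' + C b * th Φ ∈ annIdeal K Φ := by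
    have := sub_mem hf (JJ_le hΦ hp h3)
    rwa [sub_sub_cancel] at this
  have hth1 : Φ (th Φ) = 1 := by rw [th, Phi_vv hp, if_pos rfl]
  have hX := isHomogeneous_X K (0 : Fin 4)
  have e3 : ∀ t : MvPolynomial (Fin 4) K, Φ (C a * t) + Φ (l * t) + Φ (X 0 * l' * t) + Φ (C b * th Φ * t) = 0 := by
    intro t
    have := hr t
    rwa [add_mul, add_mul, add_mul, map_add, map_add, map_add] at this
  have ha : a = 0 := by
    have := e3 (th Φ)
    rw [Phi_hom hΦ (h1.mul th_hom) (by norm_num), Phi_hom hΦ ((hX.mul h2).mul th_hom) (by norm_num),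
      Phi_hom hΦ ((th_hom.C_mul b).mul th_hom) (by norm_num), ← smul_eq_C_mul, map_smul, hth1] at this
    simpa using this
  have hl : l = 0 := by
    apply p_inj hp h1
    intro c
    have hh := hX.mul (isHomogeneous_X K c)
    have := e3 (X 0 * X c)
    rw [ha, Phi_hom hΦ ((hX.mul h2).mul hh) (by norm_num),
      Phi_hom hΦ ((th_hom.C_mul b).mul hh) (by norm_num)] at this
    rw [C_0, zero_mul, map_zero, zero_add, add_zero, add_zero] at this
    have e : X 0 * l * X c = l * (X 0 * X c) := by ring
    rw [e]
    exact this
  have hl' : l' = 0 := by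
    apply p_inj hp h2
    intro c
    have hh := isHomogeneous_X K c
    have := e3 (X c)
    rw [ha, hl, Phi_hom hΦ ((th_hom.C_mul b).mul hh) (by norm_num)] at this
    simpa using this
  have hb : b = 0 := by
    have := e3 1
    have e : Φ (C b * th Φ) = b := by
      rw [← smul_eq_C_mul, map_smul, hth1, smul_eq_mul, mul_one]
    rw [ha, hl, hl', mul_one (C b * _), e] at this
    simpa using this
  rw [ha, hl, hl', hb] at h3
  simpa using h3

end Ident2

/-- **Theorem 5.1** (second part).  Assume `Φ` is a degree-3 Macaulay inverse
system on `P = k[x,y,z,w]` whose annihilator contains no nonzero linear form,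
and that the map `p` is bijective.  Then `P/ann Φ` admits a free resolution of
length four with total Betti numbers `(1, 9, 16, 9, 1)`. -/
theorem exists_free_resolution_betti_1_9_16_9_1
    (Φ : MvPolynomial (Fin 4) k →ₗ[k] k)
    (hΦ : ∀ m : Fin 4 →₀ ℕ, (m.sum fun _ e => e) ≠ 3 → Φ (monomial m 1) = 0)
    (hlin : ∀ u ∈ homogeneousSubmodule (Fin 4) k 1, u ∈ annIdeal k Φ → u = 0)
    (hp : Function.Bijective (pMap k Φ)) :
    ∃ (f₄ : MvPolynomial (Fin 4) k →ₗ[MvPolynomial (Fin 4) k] (Fin 9 → MvPolynomial (Fin 4) k))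
      (f₃ : (Fin 9 → MvPolynomial (Fin 4) k) →ₗ[MvPolynomial (Fin 4) k]
        (Fin 16 → MvPolynomial (Fin 4) k))
      (f₂ : (Fin 16 → MvPolynomial (Fin 4) k) →ₗ[MvPolynomial (Fin 4) k]
        (Fin 9 → MvPolynomial (Fin 4) k))
      (f₁ : (Fin 9 → MvPolynomial (Fin 4) k) →ₗ[MvPolynomial (Fin 4) k] MvPolynomial (Fin 4) k),
      Function.Injective f₄ ∧
        LinearMap.range f₄ = LinearMap.ker f₃ ∧
        LinearMap.range f₃ = LinearMap.ker f₂ ∧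
        LinearMap.range f₂ = LinearMap.ker f₁ ∧
        LinearMap.range f₁ = annIdeal k Φ := by
  have hmd := md_of hp
  obtain ⟨f₄, f₃, f₂, f₁, h1, h2, h3, h4, h5⟩ := elim_main (rels_of hmd) (hmd.slots X)
  refine ⟨f₄, f₃, f₂, f₁, h1, h2, h3, h4, ?_⟩
  ext p
  rw [h5]
  constructor
  · intro h
    exact JJ_le hΦ hp h
  · intro h
    exact ann_le hΦ hp h

end
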